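/- Let B ⊂ ℝⁿ be an open ball centered at the origin. Every function g ∈ C²(B) satisfying Δg + g = 0 on B can be approximated, uniformly together with all derivatives up to any fixed order t on compact subsets of B, by finite linear combinations of the functions x ↦ Y^ℓ_m(x/|x|) J_{ℓ+ν}(|x|)/|x|^ν. -/

import Mathlib

open MeasureTheory Metric Filter Real
open scoped RealInnerProductSpace

noncomputable section

/-- The Euclidean Laplacian of `f` at `x`: the sum of the pure second derivatives
in the coordinate directions. -/
def lap {n : ℕ} {F : Type*} [NormedAddCommGroup F] [NormedSpace ℝ F]
    (f : EuclideanSpace ℝ (Fin n) → F) (x : EuclideanSpace ℝ (Fin n)) : F :=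
  ∑ i : Fin n, iteratedFDeriv ℝ 2 f x ![EuclideanSpace.single i 1, EuclideanSpace.single i 1]

/-- Bessel function of the first kind of order `μ`, via its power series. -/
def besselJ (μ : ℝ) (r : ℝ) : ℝ :=
  ∑' k : ℕ, ((-1 : ℝ) ^ k / ((Nat.factorial k : ℝ) * Real.Gamma ((k : ℝ) + μ + 1)))
    * (r / 2) ^ (2 * k) * (r / 2) ^ μ

/-- Bessel function of the second kind of order `μ`, as the limit of the standard
combination `(J_α cos(απ) - J_{-α}) / sin(απ)` as `α → μ`. -/
def besselY (μ : ℝ) (r : ℝ) : ℝ :=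
  limUnder (nhdsWithin μ {μ}ᶜ)
    (fun α => (besselJ α r * Real.cos (α * Real.pi) - besselJ (-α) r) / Real.sin (α * Real.pi))

/-- `P` is a harmonic polynomial in `n` variables, homogeneous of degree `ℓ`.
Its restriction to the unit sphere is a spherical harmonic of degree `ℓ`. -/
def IsHarmonicHomogeneous (n ℓ : ℕ) (P : MvPolynomial (Fin n) ℝ) : Prop :=
  P.IsHomogeneous ℓ ∧
    ∀ x : EuclideanSpace ℝ (Fin n),
      lap (fun y => MvPolynomial.eval (fun i => y i) P) x = 0

/-- The value at `v` of the spherical harmonic determined by the polynomial `P`. -/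
def sphEval {n : ℕ} (P : MvPolynomial (Fin n) ℝ) (v : EuclideanSpace ℝ (Fin n)) : ℝ :=
  MvPolynomial.eval (fun i => v i) P

/-- The (unnormalized) surface measure on the unit sphere of `ℝⁿ`. -/
def sphereMeasure (n : ℕ) : Measure (sphere (0 : EuclideanSpace ℝ (Fin n)) 1) :=
  (volume : Measure (EuclideanSpace ℝ (Fin n))).toSphere

/-- The Bessel–Clifford function `z ↦ ∑ zᵏ / (k! Γ(k + μ + 1))`. -/
def besselClifford (μ z : ℝ) : ℝ :=
  ∑' k : ℕ, z ^ k / ((Nat.factorial k : ℝ) * Real.Gamma ((k : ℝ) + μ + 1))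

lemma Gamma_add_one_le_Gamma_nat_add {μ : ℝ} (hμ : 0 ≤ μ) (k : ℕ) :
    Real.Gamma (μ + 1) ≤ Real.Gamma ((k : ℝ) + μ + 1) := by
  induction k with
  | zero => simp
  | succ k ih =>
    have h1 : ((k + 1 : ℕ) : ℝ) + μ + 1 = ((k : ℝ) + μ + 1) + 1 := by push_cast; ring
    have h0 : (0 : ℝ) ≤ k := Nat.cast_nonneg k
    have hp : 0 < Real.Gamma ((k : ℝ) + μ + 1) := Real.Gamma_pos_of_pos (by linarith)
    rw [h1, Real.Gamma_add_one (by positivity : (k : ℝ) + μ + 1 ≠ 0)]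
    nlinarith

lemma abs_besselClifford_term_le {μ : ℝ} (hμ : 0 ≤ μ) (k : ℕ) {a b : ℝ} (h : |a| ≤ b) :
    ‖a / ((Nat.factorial k : ℝ) * Real.Gamma ((k : ℝ) + μ + 1))‖
      ≤ b / (Nat.factorial k : ℝ) * (Real.Gamma (μ + 1))⁻¹ := by
  have hG : 0 < Real.Gamma (μ + 1) := Real.Gamma_pos_of_pos (by linarith)
  have hG' := Gamma_add_one_le_Gamma_nat_add hμ k
  have hf : (0 : ℝ) < Nat.factorial k := by positivity
  rw [Real.norm_eq_abs, abs_div, abs_of_pos (mul_pos hf (hG.trans_le hG')), ← div_eq_mul_inv,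
    div_div]
  gcongr
  exact (abs_nonneg a).trans h

lemma summable_besselClifford {μ : ℝ} (hμ : 0 ≤ μ) (z : ℝ) :
    Summable fun k : ℕ => z ^ k / ((Nat.factorial k : ℝ) * Real.Gamma ((k : ℝ) + μ + 1)) :=
  .of_norm_bounded ((Real.summable_pow_div_factorial |z|).mul_right (Real.Gamma (μ + 1))⁻¹)
    fun k => abs_besselClifford_term_le hμ k (abs_pow z k).le

lemma besselClifford_succ_coeff (μ z : ℝ) (k : ℕ) :
    ((k + 1 : ℕ) : ℝ) * z ^ k /
        ((Nat.factorial (k + 1) : ℝ) * Real.Gamma (((k + 1 : ℕ) : ℝ) + μ + 1))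
      = z ^ k / ((Nat.factorial k : ℝ) * Real.Gamma ((k : ℝ) + (μ + 1) + 1)) := by
  have h1 : ((k + 1 : ℕ) : ℝ) + μ + 1 = (k : ℝ) + (μ + 1) + 1 := by push_cast; ring
  have hk : ((k : ℝ) + 1) ≠ 0 := by positivity
  rw [h1, Nat.factorial_succ]
  push_cast
  rw [mul_assoc, mul_div_mul_left _ _ hk]

lemma hasDerivAt_besselClifford {μ : ℝ} (hμ : 0 ≤ μ) (z : ℝ) :
    HasDerivAt (besselClifford μ) (besselClifford (μ + 1) z) z := by
  set r : ℝ := |z| + 1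
  have hr : 0 ≤ r := by positivity
  have hs : Summable fun k : ℕ =>
      (k : ℝ) * r ^ (k - 1) / (Nat.factorial k : ℝ) * (Real.Gamma (μ + 1))⁻¹ := by
    refine Summable.mul_right _ ((summable_nat_add_iff 1).1 ?_)
    refine (Real.summable_pow_div_factorial r).congr fun k => ?_
    have hk : ((k : ℝ) + 1) ≠ 0 := by positivity
    rw [Nat.factorial_succ]
    push_cast
    rw [mul_div_mul_left _ _ hk]
  have hz : z ∈ ball (0 : ℝ) r := by simp [r]
  have key := hasDerivAt_tsum_of_isPreconnected (t := ball (0 : ℝ) r) (y₀ := z)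
    (g := fun (k : ℕ) (y : ℝ) => y ^ k / ((Nat.factorial k : ℝ) * Real.Gamma ((k : ℝ) + μ + 1)))
    (g' := fun (k : ℕ) (y : ℝ) => (k : ℝ) * y ^ (k - 1) /
      ((Nat.factorial k : ℝ) * Real.Gamma ((k : ℝ) + μ + 1))) hs isOpen_ball
    (convex_ball _ _).isPreconnected (fun k y _ => (hasDerivAt_pow k y).div_const _)
    (fun k y hy => abs_besselClifford_term_le hμ k (by
      rw [abs_mul, abs_pow, Nat.abs_cast]
      gcongr
      simpa using (mem_ball_zero_iff.1 hy).le)) hz (summable_besselClifford hμ z) hz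
  convert! key using 1
  have h1 := summable_besselClifford (μ := μ + 1) (by linarith) z
  rw [Summable.tsum_eq_zero_add ((summable_nat_add_iff 1).1 (h1.congr fun k => by
    rw [← besselClifford_succ_coeff, Nat.add_sub_cancel]))]
  simp only [Nat.add_sub_cancel, besselClifford_succ_coeff]
  simp [besselClifford]

lemma besselClifford_recurrence {μ : ℝ} (hμ : 0 ≤ μ) (z : ℝ) :
    z * besselClifford (μ + 2) z + (μ + 1) * besselClifford (μ + 1) z = besselClifford μ z := by
  have h0 := summable_besselClifford hμ z
  have h1 := summable_besselClifford (μ := μ + 1) (by linarith) z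
  rw [← eq_sub_iff_add_eq, eq_comm, besselClifford, besselClifford, ← tsum_mul_left,
    ← Summable.tsum_sub h0 (h1.mul_left _), besselClifford, ← tsum_mul_left]
  rw [Summable.tsum_eq_zero_add (h0.sub (h1.mul_left _))]
  have hne (k : ℕ) : (k : ℝ) + μ + 1 ≠ 0 := by positivity
  have hG (k : ℕ) : Real.Gamma ((k : ℝ) + (μ + 1) + 1)
      = ((k : ℝ) + μ + 1) * Real.Gamma ((k : ℝ) + μ + 1) := by
    rw [← Real.Gamma_add_one (hne k)]; ring_nf
  have hGp (k : ℕ) : Real.Gamma ((k : ℝ) + μ + 1) ≠ 0 :=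
    (Real.Gamma_pos_of_pos (by positivity)).ne'
  have hzero : z ^ 0 / ((Nat.factorial 0 : ℝ) * Real.Gamma (((0 : ℕ) : ℝ) + μ + 1)) -
      (μ + 1) * (z ^ 0 / ((Nat.factorial 0 : ℝ) * Real.Gamma (((0 : ℕ) : ℝ) + (μ + 1) + 1)))
        = 0 := by
    have := hGp 0
    have := hne 0
    rw [hG 0]
    simp only [CharP.cast_eq_zero, zero_add] at *
    field_simp
    simp
  rw [hzero, zero_add]
  refine tsum_congr fun k => ?_
  have e1 : (k : ℝ) + (μ + 2) + 1 = ((k + 1 : ℕ) : ℝ) + (μ + 1) + 1 := by push_cast; ring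
  rw [e1, hG (k + 1), Nat.factorial_succ]
  have := hGp (k + 1)
  have := hne (k + 1)
  have : (Nat.factorial k : ℝ) ≠ 0 := by positivity
  push_cast at *
  field_simp
  ring

lemma continuous_besselClifford {μ : ℝ} (hμ : 0 ≤ μ) : Continuous (besselClifford μ) :=
  continuous_iff_continuousAt.2 fun z => (hasDerivAt_besselClifford hμ z).continuousAt

lemma contDiff_besselClifford {μ : ℝ} (hμ : 0 ≤ μ) :
    ContDiff ℝ (⊤ : ℕ∞) (besselClifford μ) := by
  refine contDiff_infty.2 fun k => ?_
  induction k generalizing μ with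
  | zero => exact contDiff_zero.2 (continuous_besselClifford hμ)
  | succ k ih =>
    have hd : deriv (besselClifford μ) = besselClifford (μ + 1) :=
      funext fun z => (hasDerivAt_besselClifford hμ z).deriv
    refine (contDiff_succ_iff_deriv (n := (k : WithTop ℕ∞))).2
      ⟨fun z => (hasDerivAt_besselClifford hμ z).differentiableAt, by simp, ?_⟩
    rw [hd]
    exact ih (by linarith)

lemma besselClifford_zero_pos {μ : ℝ} (hμ : 0 ≤ μ) : 0 < besselClifford μ 0 := by
  have : besselClifford μ 0 = (Real.Gamma (μ + 1))⁻¹ := by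
    rw [besselClifford, tsum_eq_single 0 (fun k hk => by simp [hk])]
    simp
  rw [this]
  exact inv_pos.2 (Real.Gamma_pos_of_pos (by linarith))

lemma besselJ_eq_besselClifford (μ r : ℝ) :
    besselJ μ r = (r / 2) ^ μ * besselClifford μ (-r ^ 2 / 4) := by
  rw [besselJ, tsum_mul_right, mul_comm, besselClifford]
  congr 1
  refine tsum_congr fun k => ?_
  have : (-r ^ 2 / 4) ^ k = (-1) ^ k * (r / 2) ^ (2 * k) := by
    rw [pow_mul, ← mul_pow]; ring
  rw [this]; ring

lemma ContDiff.two_of_infty {E F : Type*} [NormedAddCommGroup E] [NormedSpace ℝ E]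
    [NormedAddCommGroup F] [NormedSpace ℝ F] {f : E → F} (h : ContDiff ℝ (⊤ : ℕ∞) f) :
    ContDiff ℝ 2 f := by
  exact_mod_cast contDiff_infty.1 h 2

/-- The partial derivative of `f` in the direction of the `i`-th basis vector. -/
def partialDeriv {n : ℕ} (i : Fin n) (f : EuclideanSpace ℝ (Fin n) → ℝ)
    (x : EuclideanSpace ℝ (Fin n)) : ℝ :=
  fderiv ℝ f x (EuclideanSpace.single i 1)

/-- On the set `U`, the functions `f₁ i` and `f₂ i` are the first and second derivatives of `f`
along the `i`-th coordinate line. -/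
structure HasSecondPartials {n : ℕ} (f : EuclideanSpace ℝ (Fin n) → ℝ)
    (f₁ f₂ : Fin n → EuclideanSpace ℝ (Fin n) → ℝ) (U : Set (EuclideanSpace ℝ (Fin n))) :
    Prop where
  fst : ∀ x ∈ U, ∀ i, HasLineDerivAt ℝ f (f₁ i x) x (EuclideanSpace.single i 1)
  snd : ∀ x ∈ U, ∀ i, HasLineDerivAt ℝ (f₁ i) (f₂ i x) x (EuclideanSpace.single i 1)

lemma HasLineDerivAt.add_fun {E : Type*} [AddCommGroup E] [Module ℝ E] {f g : E → ℝ} {a b : ℝ}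
    {x v : E} (hf : HasLineDerivAt ℝ f a x v) (hg : HasLineDerivAt ℝ g b x v) :
    HasLineDerivAt ℝ (fun y => f y + g y) (a + b) x v :=
  HasDerivAt.add hf hg

lemma HasLineDerivAt.mul_fun {E : Type*} [AddCommGroup E] [Module ℝ E] {f g : E → ℝ} {a b : ℝ}
    {x v : E} (hf : HasLineDerivAt ℝ f a x v) (hg : HasLineDerivAt ℝ g b x v) :
    HasLineDerivAt ℝ (fun y => f y * g y) (a * g x + f x * b) x v := by
  have := HasDerivAt.mul hf hg
  simpa using! this

namespace HasSecondPartials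

variable {n : ℕ} {f g : EuclideanSpace ℝ (Fin n) → ℝ}
  {f₁ f₂ g₁ g₂ : Fin n → EuclideanSpace ℝ (Fin n) → ℝ} {U : Set (EuclideanSpace ℝ (Fin n))}

lemma mono (hf : HasSecondPartials f f₁ f₂ U) {V : Set (EuclideanSpace ℝ (Fin n))} (h : V ⊆ U) :
    HasSecondPartials f f₁ f₂ V :=
  ⟨fun x hx => hf.fst x (h hx), fun x hx => hf.snd x (h hx)⟩

lemma add (hf : HasSecondPartials f f₁ f₂ U) (hg : HasSecondPartials g g₁ g₂ U) :
    HasSecondPartials (fun x => f x + g x) (fun i x => f₁ i x + g₁ i x)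
      (fun i x => f₂ i x + g₂ i x) U :=
  ⟨fun x hx i => (hf.fst x hx i).add_fun (hg.fst x hx i),
    fun x hx i => (hf.snd x hx i).add_fun (hg.snd x hx i)⟩

lemma mul (hf : HasSecondPartials f f₁ f₂ U) (hg : HasSecondPartials g g₁ g₂ U) :
    HasSecondPartials (fun x => f x * g x) (fun i x => f₁ i x * g x + f x * g₁ i x)
      (fun i x => f₂ i x * g x + 2 * (f₁ i x * g₁ i x) + f x * g₂ i x) U := by
  refine ⟨fun x hx i => (hf.fst x hx i).mul_fun (hg.fst x hx i), fun x hx i => ?_⟩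
  convert ((hf.snd x hx i).mul_fun (hg.fst x hx i)).add_fun
    ((hf.fst x hx i).mul_fun (hg.snd x hx i)) using 1
  ring

lemma const (c : ℝ) : HasSecondPartials (n := n) (fun _ => c) (fun _ _ => 0) (fun _ _ => 0) U :=
  ⟨fun _ _ _ => hasDerivAt_const _ _, fun _ _ _ => hasDerivAt_const _ _⟩

lemma const_mul (hf : HasSecondPartials f f₁ f₂ U) (c : ℝ) :
    HasSecondPartials (fun x => c * f x) (fun i x => c * f₁ i x) (fun i x => c * f₂ i x) U :=
  ⟨fun x hx i => HasDerivAt.const_mul c (hf.fst x hx i),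
    fun x hx i => HasDerivAt.const_mul c (hf.snd x hx i)⟩

lemma normSq : HasSecondPartials (n := n) (fun x => ‖x‖ ^ 2) (fun i x => 2 * x i)
    (fun _ _ => 2) U := by
  refine ⟨fun x _ i => ?_, fun x _ i => ?_⟩
  · have := (hasStrictFDerivAt_norm_sq x).hasFDerivAt.hasLineDerivAt (EuclideanSpace.single i 1)
    simpa [EuclideanSpace.inner_single_right] using this
  · have h := (((hasDerivAt_id (0 : ℝ)).const_add (x i))).const_mul 2
    simpa [HasLineDerivAt] using! h

lemma comp_normSq {ψ ψ' ψ'' : ℝ → ℝ} (h : ∀ r, HasDerivAt ψ (ψ' r) r)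
    (h' : ∀ r, HasDerivAt ψ' (ψ'' r) r) :
    HasSecondPartials (n := n) (fun x => ψ (‖x‖ ^ 2)) (fun i x => 2 * x i * ψ' (‖x‖ ^ 2))
      (fun i x => 2 * ψ' (‖x‖ ^ 2) + 4 * x i ^ 2 * ψ'' (‖x‖ ^ 2)) U := by
  have key {ψ ψ' : ℝ → ℝ} (h : ∀ r, HasDerivAt ψ (ψ' r) r) (x : EuclideanSpace ℝ (Fin n))
      (i : Fin n) : HasLineDerivAt ℝ (fun x => ψ (‖x‖ ^ 2)) (2 * x i * ψ' (‖x‖ ^ 2)) x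
        (EuclideanSpace.single i 1) := by
    have h1 : HasDerivAt (fun s : ℝ => ‖x + s • EuclideanSpace.single i (1 : ℝ)‖ ^ 2) (2 * x i) 0 :=
      (normSq (U := Set.univ)).fst x trivial i
    have h2 := (h (‖x + (0 : ℝ) • EuclideanSpace.single i (1 : ℝ)‖ ^ 2)).comp 0 h1
    rw [zero_smul, add_zero, mul_comm] at h2
    exact h2
  refine ⟨fun x _ i => key h x i, fun x _ i => ?_⟩
  convert ((normSq (U := Set.univ)).snd x trivial i).mul_fun (key h' x i) using 1
  ring

lemma of_contDiff (hf : ContDiff ℝ 2 f) :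
    HasSecondPartials f (fun i => partialDeriv i f) (fun i => partialDeriv i (partialDeriv i f))
      U := by
  have h1 : ContDiff ℝ 1 (fderiv ℝ f) := hf.fderiv_right le_rfl
  refine ⟨fun x _ i => ?_, fun x _ i => ?_⟩
  · exact ((hf.differentiable (by norm_num)) x).hasFDerivAt.hasLineDerivAt _
  · have : ContDiff ℝ 1 (partialDeriv i f) := h1.clm_apply contDiff_const
    exact ((this.differentiable (by norm_num)) x).hasFDerivAt.hasLineDerivAt _

lemma comp_smul (hf : ContDiff ℝ 2 f) (t : ℝ) :
    HasSecondPartials (fun x => f (t • x)) (fun i x => t * partialDeriv i f (t • x))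
      (fun i x => t ^ 2 * partialDeriv i (partialDeriv i f) (t • x)) U := by
  have key {h : EuclideanSpace ℝ (Fin n) → ℝ} (hh : Differentiable ℝ h)
      (x : EuclideanSpace ℝ (Fin n)) (i : Fin n) :
      HasLineDerivAt ℝ (fun x => h (t • x)) (t * partialDeriv i h (t • x)) x
        (EuclideanSpace.single i 1) := by
    have := ((hh (t • x)).hasFDerivAt.comp x ((hasFDerivAt_id x).const_smul t)).hasLineDerivAt
      (EuclideanSpace.single i 1)
    simpa [partialDeriv] using! this
  have h1 : ContDiff ℝ 1 (fderiv ℝ f) := hf.fderiv_right le_rfl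
  refine ⟨fun x _ i => key (hf.differentiable (by norm_num)) x i, fun x _ i => ?_⟩
  have hp : ContDiff ℝ 1 (partialDeriv i f) := h1.clm_apply contDiff_const
  have := HasDerivAt.const_mul t (key (hp.differentiable (by norm_num)) x i)
  rw [← mul_assoc, ← pow_two] at this
  exact this

end HasSecondPartials

lemma lap_eq_sum_partialDeriv {n : ℕ} {f : EuclideanSpace ℝ (Fin n) → ℝ} (hf : ContDiff ℝ 2 f)
    (x : EuclideanSpace ℝ (Fin n)) :
    lap f x = ∑ i, partialDeriv i (partialDeriv i f) x := by
  have h1 : ContDiff ℝ 1 (fderiv ℝ f) := hf.fderiv_right le_rfl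
  refine Finset.sum_congr rfl fun i _ => ?_
  have : partialDeriv i f = fun y => fderiv ℝ f y (EuclideanSpace.single i 1) := rfl
  rw [iteratedFDeriv_two_apply, partialDeriv, this,
    fderiv_clm_apply ((h1.differentiable (by norm_num)) x) (differentiableAt_const _)]
  simp

lemma lap_eq_sum_of_hasSecondPartials {n : ℕ} {f : EuclideanSpace ℝ (Fin n) → ℝ}
    (hf : ContDiff ℝ 2 f) {f₁ f₂ : Fin n → EuclideanSpace ℝ (Fin n) → ℝ}
    (h : HasSecondPartials f f₁ f₂ Set.univ) (x : EuclideanSpace ℝ (Fin n)) :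
    lap f x = ∑ i, f₂ i x := by
  have h0 := HasSecondPartials.of_contDiff (U := Set.univ) hf
  rw [lap_eq_sum_partialDeriv hf]
  refine Finset.sum_congr rfl fun i _ => ?_
  have : f₁ i = partialDeriv i f :=
    funext fun y => (h.fst y trivial i).unique (h0.fst y trivial i)
  have h2 := h.snd x trivial i
  rw [this] at h2
  exact (h0.snd x trivial i).unique h2

lemma IsLocalMax.second_deriv_nonpos {φ φ' : ℝ → ℝ} {a c : ℝ} (hm : IsLocalMax φ a)
    (h1 : ∀ᶠ s in nhds a, HasDerivAt φ (φ' s) s) (h2 : HasDerivAt φ' c a) : c ≤ 0 := by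
  by_contra! hc
  have hd : deriv φ =ᶠ[nhds a] φ' := h1.mono fun s hs => hs.deriv
  have hdd : deriv (deriv φ) a = c := by rw [hd.deriv_eq, h2.deriv]
  have hmin := isLocalMin_of_deriv_deriv_pos (hdd ▸ hc) hm.deriv_eq_zero
    h1.self_of_nhds.continuousAt
  have hconst : φ =ᶠ[nhds a] fun _ => φ a := by
    filter_upwards [hm, hmin] with s hs hs' using le_antisymm hs hs'
  have : deriv (deriv φ) a = 0 := by
    rw [hconst.deriv.deriv_eq]; simp
  linarith

/-- The maximum principle for subharmonic functions on a ball. -/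
lemma HasSecondPartials.le_of_le_on_sphere {n : ℕ} (hn : 0 < n) {R M : ℝ}
    {f : EuclideanSpace ℝ (Fin n) → ℝ} {f₁ f₂ : Fin n → EuclideanSpace ℝ (Fin n) → ℝ}
    (hf : HasSecondPartials f f₁ f₂ (ball 0 R)) (hc : ContinuousOn f (closedBall 0 R))
    (hlap : ∀ x ∈ ball (0 : EuclideanSpace ℝ (Fin n)) R, 0 ≤ ∑ i, f₂ i x)
    (hM : ∀ x ∈ sphere (0 : EuclideanSpace ℝ (Fin n)) R, f x ≤ M)
    {x : EuclideanSpace ℝ (Fin n)} (hx : x ∈ closedBall (0 : EuclideanSpace ℝ (Fin n)) R) :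
    f x ≤ M := by
  refine le_of_forall_pos_le_add fun η hη => ?_
  obtain ⟨δ, hδ, hδη⟩ : ∃ δ > 0, δ * R ^ 2 ≤ η :=
    ⟨η / (R ^ 2 + 1), by positivity, by rw [div_mul_eq_mul_div, div_le_iff₀] <;> nlinarith⟩
  set w : EuclideanSpace ℝ (Fin n) → ℝ := fun y => f y + δ * ‖y‖ ^ 2
  have hw := hf.add ((HasSecondPartials.normSq (U := ball 0 R)).const_mul δ)
  have hwc : ContinuousOn w (closedBall 0 R) := hc.add (by fun_prop)
  obtain ⟨z, hz, hzmax⟩ := (isCompact_closedBall (0 : EuclideanSpace ℝ (Fin n)) R).exists_isMaxOn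
    ⟨x, hx⟩ hwc
  have hxz : w x ≤ w z := hzmax hx
  have hz' : z ∈ sphere (0 : EuclideanSpace ℝ (Fin n)) R := by
    by_contra hzs
    have hzb : z ∈ ball (0 : EuclideanSpace ℝ (Fin n)) R := by
      rw [mem_ball]
      exact lt_of_le_of_ne hz hzs
    have hloc : IsLocalMax w z :=
      Filter.mem_of_superset (isOpen_ball.mem_nhds hzb)
        fun y hy => hzmax (ball_subset_closedBall hy)
    have hi (i : Fin n) : f₂ i z + δ * 2 ≤ 0 := by
      have hline : Continuous fun s : ℝ => z + s • EuclideanSpace.single i (1 : ℝ) := by fun_prop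
      have ht : Tendsto (fun s : ℝ => z + s • EuclideanSpace.single i (1 : ℝ)) (nhds 0)
          (nhds z) := by simpa using hline.tendsto 0
      refine IsLocalMax.second_deriv_nonpos
        (φ := fun s => w (z + s • EuclideanSpace.single i (1 : ℝ)))
        (φ' := fun s => f₁ i (z + s • EuclideanSpace.single i (1 : ℝ)) +
          δ * (2 * (z + s • EuclideanSpace.single i (1 : ℝ)) i))
        (a := 0) ?_ ?_ (hw.snd z hzb i)
      · have := ht.eventually hloc
        simpa [IsLocalMax, IsMaxFilter] using this
      · filter_upwards [ht.eventually (isOpen_ball.mem_nhds hzb)] with s hs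
        have h3 : HasDerivAt (fun r : ℝ => w ((z + s • EuclideanSpace.single i (1 : ℝ))
          + r • EuclideanSpace.single i (1 : ℝ))) _ 0 := hw.fst _ hs i
        have h4 := HasDerivAt.comp_sub_const s s (by simpa only [sub_self] using h3)
        simpa only [sub_smul, add_assoc, add_sub_cancel] using! h4
    have hsum : ∑ i, (f₂ i z + δ * 2) ≤ 0 := Finset.sum_nonpos fun i _ => hi i
    rw [Finset.sum_add_distrib] at hsum
    have := hlap z hzb
    simp only [Finset.sum_const, Finset.card_univ, Fintype.card_fin, nsmul_eq_mul] at hsum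
    have hn' : (0 : ℝ) < n := by exact_mod_cast hn
    nlinarith [mul_pos hn' hδ]
  have hzR : ‖z‖ = R := by simpa using hz'
  have h1 := hM z hz'
  have h2 : 0 ≤ δ * ‖x‖ ^ 2 := by positivity
  simp only [w, hzR] at hxz
  linarith

/-- The Laplacian of a polynomial, as a formal linear operator. -/
def mvLap (n : ℕ) : MvPolynomial (Fin n) ℝ →ₗ[ℝ] MvPolynomial (Fin n) ℝ :=
  ∑ i, (MvPolynomial.pderiv i).toLinearMap ∘ₗ (MvPolynomial.pderiv i).toLinearMap

lemma mvLap_apply {n : ℕ} (p : MvPolynomial (Fin n) ℝ) :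
    mvLap n p = ∑ i, MvPolynomial.pderiv i (MvPolynomial.pderiv i p) := by
  simp [mvLap]

lemma sphEval_add {n : ℕ} (p q : MvPolynomial (Fin n) ℝ) :
    sphEval (p + q) = fun x => sphEval p x + sphEval q x := by
  ext; simp [sphEval]

lemma sphEval_C {n : ℕ} (a : ℝ) :
    sphEval (MvPolynomial.C a) = fun _ : EuclideanSpace ℝ (Fin n) => a := by
  ext; simp [sphEval]

lemma sphEval_mul_X {n : ℕ} (p : MvPolynomial (Fin n) ℝ) (j : Fin n) :
    sphEval (p * MvPolynomial.X j) = fun x => sphEval p x * x j := by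
  ext; simp [sphEval]

lemma hasLineDerivAt_sphEval {n : ℕ} (p : MvPolynomial (Fin n) ℝ) (i : Fin n)
    (x : EuclideanSpace ℝ (Fin n)) :
    HasLineDerivAt ℝ (sphEval p) (sphEval (MvPolynomial.pderiv i p) x) x
      (EuclideanSpace.single i 1) := by
  induction p using MvPolynomial.induction_on with
  | C a =>
    rw [sphEval_C, MvPolynomial.pderiv_C]
    simpa [sphEval] using! hasDerivAt_const _ a
  | add p q hp hq =>
    rw [map_add, sphEval_add, sphEval_add]
    exact hp.add_fun hq
  | mul_X p j hp =>
    have hX : HasLineDerivAt ℝ (fun y : EuclideanSpace ℝ (Fin n) => y j)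
        (if j = i then 1 else 0) x (EuclideanSpace.single i 1) := by
      have := ((hasDerivAt_id (0 : ℝ)).mul_const (if j = i then (1 : ℝ) else 0)).const_add (x j)
      simpa [HasLineDerivAt, Pi.single_apply] using! this
    have := hp.mul_fun hX
    rw [sphEval_mul_X]
    convert this using 1
    simp only [sphEval, MvPolynomial.pderiv_mul, map_add, map_mul, MvPolynomial.eval_X,
      MvPolynomial.pderiv_X, Pi.single_apply]
    split_ifs <;> simp_all

lemma hasSecondPartials_sphEval {n : ℕ} (p : MvPolynomial (Fin n) ℝ)
    (U : Set (EuclideanSpace ℝ (Fin n))) :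
    HasSecondPartials (sphEval p) (fun i => sphEval (MvPolynomial.pderiv i p))
      (fun i => sphEval (MvPolynomial.pderiv i (MvPolynomial.pderiv i p))) U :=
  ⟨fun x _ i => hasLineDerivAt_sphEval p i x, fun x _ i => hasLineDerivAt_sphEval _ i x⟩

lemma contDiff_sphEval {n : ℕ} (p : MvPolynomial (Fin n) ℝ) :
    ContDiff ℝ (⊤ : ℕ∞) (sphEval p) := by
  induction p using MvPolynomial.induction_on with
  | C a => rw [sphEval_C]; exact contDiff_const
  | add p q hp hq => rw [sphEval_add]; exact hp.add hq
  | mul_X p j hp => rw [sphEval_mul_X]; exact hp.mul (by fun_prop)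

lemma sum_sphEval_pderiv {n : ℕ} (p : MvPolynomial (Fin n) ℝ) (x : EuclideanSpace ℝ (Fin n)) :
    ∑ i, sphEval (MvPolynomial.pderiv i (MvPolynomial.pderiv i p)) x = sphEval (mvLap n p) x := by
  simp [sphEval, mvLap_apply]

lemma lap_sphEval {n : ℕ} (p : MvPolynomial (Fin n) ℝ) (x : EuclideanSpace ℝ (Fin n)) :
    lap (sphEval p) x = sphEval (mvLap n p) x := by
  rw [lap_eq_sum_of_hasSecondPartials (contDiff_sphEval p).two_of_infty
    (hasSecondPartials_sphEval p _), sum_sphEval_pderiv]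

lemma isHarmonicHomogeneous_of_mvLap_eq_zero {n ℓ : ℕ} {p : MvPolynomial (Fin n) ℝ}
    (hp : p.IsHomogeneous ℓ) (h : mvLap n p = 0) : IsHarmonicHomogeneous n ℓ p :=
  ⟨hp, fun x => (lap_sphEval p x).trans (by simp [h, sphEval])⟩

lemma totalDegree_le_iff_degree_le {n d : ℕ} {p : MvPolynomial (Fin n) ℝ} :
    p.totalDegree ≤ d ↔ ∀ m : Fin n →₀ ℕ, p.coeff m ≠ 0 → m.degree ≤ d := by
  rw [MvPolynomial.totalDegree, Finset.sup_le_iff]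
  simp only [MvPolynomial.mem_support_iff]
  rfl

lemma totalDegree_pderiv_le {n d : ℕ} {p : MvPolynomial (Fin n) ℝ} (i : Fin n)
    (hp : p.totalDegree ≤ d + 1) : (MvPolynomial.pderiv i p).totalDegree ≤ d := by
  rw [totalDegree_le_iff_degree_le] at hp ⊢
  intro m hm
  rw [MvPolynomial.coeff_pderiv] at hm
  have := hp _ (left_ne_zero_of_mul hm)
  rw [map_add, Finsupp.degree_single] at this
  omega

lemma totalDegree_mvLap_le {n d : ℕ} {p : MvPolynomial (Fin n) ℝ} (hp : p.totalDegree ≤ d + 2) :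
    (mvLap n p).totalDegree ≤ d := by
  rw [mvLap_apply]
  exact MvPolynomial.totalDegree_finsetSum_le fun i _ =>
    totalDegree_pderiv_le i (totalDegree_pderiv_le i hp)

lemma mvLap_homogeneousComponent {n : ℕ} {p : MvPolynomial (Fin n) ℝ} (hp : mvLap n p = 0)
    (k : ℕ) : mvLap n (MvPolynomial.homogeneousComponent k p) = 0 := by
  ext m
  have h := congrArg (MvPolynomial.coeff m) hp
  simp only [mvLap_apply, MvPolynomial.coeff_sum, MvPolynomial.coeff_pderiv,
    MvPolynomial.coeff_homogeneousComponent, map_add, Finsupp.degree_single,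
    MvPolynomial.coeff_zero] at h ⊢
  split_ifs
  · exact h
  · simp

/-- The polynomial `|X|² - R²`. -/
def sphereDefiningPoly (n : ℕ) (R : ℝ) : MvPolynomial (Fin n) ℝ :=
  ∑ i, MvPolynomial.X i ^ 2 - MvPolynomial.C (R ^ 2)

lemma sphEval_sphereDefiningPoly_mul {n : ℕ} (R : ℝ) (p : MvPolynomial (Fin n) ℝ)
    (x : EuclideanSpace ℝ (Fin n)) :
    sphEval (sphereDefiningPoly n R * p) x = (‖x‖ ^ 2 - R ^ 2) * sphEval p x := by
  simp [sphEval, sphereDefiningPoly, EuclideanSpace.real_norm_sq_eq]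

lemma totalDegree_sphereDefiningPoly_mul_le {n d : ℕ} (R : ℝ) {p : MvPolynomial (Fin n) ℝ}
    (hp : p.totalDegree ≤ d) : (sphereDefiningPoly n R * p).totalDegree ≤ d + 2 := by
  have h : (sphereDefiningPoly n R).totalDegree ≤ 2 := by
    refine (MvPolynomial.totalDegree_sub _ _).trans (max_le ?_
      (by rw [MvPolynomial.totalDegree_C]; omega))
    exact MvPolynomial.totalDegree_finsetSum_le fun i _ =>
      (MvPolynomial.totalDegree_pow _ _).trans (by simp)
  exact (MvPolynomial.totalDegree_mul _ _).trans (by omega)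

lemma eq_zero_of_sphEval_eq_zero_on_ball {n : ℕ} {R : ℝ} (hR : 0 < R)
    {p : MvPolynomial (Fin n) ℝ}
    (h : ∀ x ∈ ball (0 : EuclideanSpace ℝ (Fin n)) R, sphEval p x = 0) : p = 0 := by
  refine MvPolynomial.funext_set (fun _ => Set.Ioo 0 (R / (n + 1)))
    (fun _ => Set.Ioo_infinite (by positivity)) fun x hx => ?_
  rw [map_zero]
  refine h (WithLp.toLp 2 x) ?_
  rw [mem_ball_zero_iff]
  refine abs_lt_of_sq_lt_sq' ?_ hR.le |>.2
  rw [EuclideanSpace.real_norm_sq_eq]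
  calc ∑ i, (WithLp.toLp 2 x) i ^ 2 ≤ ∑ _i : Fin n, (R / (n + 1)) ^ 2 := by
        refine Finset.sum_le_sum fun i _ => ?_
        have := hx i trivial
        exact pow_le_pow_left₀ this.1.le this.2.le 2
    _ < R ^ 2 := by
        rw [Finset.sum_const, Finset.card_univ, Fintype.card_fin, nsmul_eq_mul, div_pow,
          mul_div_assoc', div_lt_iff₀ (by positivity), mul_comm]
        have : (n : ℝ) < (n + 1) ^ 2 := by nlinarith [(Nat.cast_nonneg n : (0 : ℝ) ≤ n)]
        exact mul_lt_mul_of_pos_left this (by positivity)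

lemma HasSecondPartials.abs_le_of_abs_le_on_sphere {n : ℕ} (hn : 0 < n) {R M : ℝ}
    {f : EuclideanSpace ℝ (Fin n) → ℝ} {f₁ f₂ : Fin n → EuclideanSpace ℝ (Fin n) → ℝ}
    (hf : HasSecondPartials f f₁ f₂ (ball 0 R)) (hc : ContinuousOn f (closedBall 0 R))
    (hlap : ∀ x ∈ ball (0 : EuclideanSpace ℝ (Fin n)) R, ∑ i, f₂ i x = 0)
    (hM : ∀ x ∈ sphere (0 : EuclideanSpace ℝ (Fin n)) R, |f x| ≤ M)
    {x : EuclideanSpace ℝ (Fin n)} (hx : x ∈ closedBall (0 : EuclideanSpace ℝ (Fin n)) R) :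
    |f x| ≤ M := by
  refine abs_le'.2 ⟨hf.le_of_le_on_sphere hn hc (fun y hy => (hlap y hy).ge)
    (fun y hy => (abs_le'.1 (hM y hy)).1) hx, ?_⟩
  have := (hf.const_mul (-1)).le_of_le_on_sphere hn (hc.const_mul (-1) :)
    (fun y hy => by rw [← Finset.mul_sum, hlap y hy, mul_zero]) (M := M)
    (fun y hy => by linarith [(abs_le'.1 (hM y hy)).2]) hx
  linarith

lemma exists_mvLap_sphereDefiningPoly_mul_eq {n : ℕ} (hn : 0 < n) {R : ℝ} (hR : 0 < R)
    (q : MvPolynomial (Fin n) ℝ) : ∃ w, mvLap n (sphereDefiningPoly n R * w) = q := by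
  set V := MvPolynomial.restrictTotalDegree (Fin n) ℝ q.totalDegree
  let T : V →ₗ[ℝ] V := (mvLap n ∘ₗ LinearMap.mulLeft ℝ (sphereDefiningPoly n R)).restrict
    fun p hp => (MvPolynomial.mem_restrictTotalDegree _ _ _).2 (totalDegree_mvLap_le
      (totalDegree_sphereDefiningPoly_mul_le R ((MvPolynomial.mem_restrictTotalDegree _ _ _).1 hp)))
  have hinj : Function.Injective T := by
    refine (injective_iff_map_eq_zero T).2 fun w hw => Subtype.ext ?_
    have hw' : mvLap n (sphereDefiningPoly n R * (w : MvPolynomial (Fin n) ℝ)) = 0 :=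
      congrArg Subtype.val hw
    refine eq_zero_of_sphEval_eq_zero_on_ball hR fun x hx => ?_
    have h0 := (hasSecondPartials_sphEval (sphereDefiningPoly n R * (w : MvPolynomial (Fin n) ℝ))
      (ball 0 R)).abs_le_of_abs_le_on_sphere hn (contDiff_sphEval _).continuous.continuousOn
      (fun y _ => by rw [sum_sphEval_pderiv, hw']; simp [sphEval]) (M := 0)
      (fun y hy => by
        rw [sphEval_sphereDefiningPoly_mul, mem_sphere_zero_iff_norm.1 hy]; simp)
      (ball_subset_closedBall hx)
    rw [abs_nonpos_iff, sphEval_sphereDefiningPoly_mul] at h0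
    refine (mul_eq_zero.1 h0).resolve_left ?_
    have := mem_ball_zero_iff.1 hx
    have := norm_nonneg x
    nlinarith
  obtain ⟨w, hw⟩ := LinearMap.injective_iff_surjective.1 hinj
    ⟨q, (MvPolynomial.mem_restrictTotalDegree _ _ _).2 le_rfl⟩
  exact ⟨w, congrArg Subtype.val hw⟩

lemma exists_harmonic_poly_eq_on_sphere {n : ℕ} (hn : 0 < n) {R : ℝ} (hR : 0 < R)
    (q : MvPolynomial (Fin n) ℝ) : ∃ H, mvLap n H = 0 ∧
      ∀ x ∈ sphere (0 : EuclideanSpace ℝ (Fin n)) R, sphEval H x = sphEval q x := by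
  obtain ⟨w, hw⟩ := exists_mvLap_sphereDefiningPoly_mul_eq hn hR (mvLap n q)
  refine ⟨q - sphereDefiningPoly n R * w, by rw [map_sub, hw, sub_self], fun x hx => ?_⟩
  have h := sphEval_sphereDefiningPoly_mul R w x
  rw [mem_sphere_zero_iff_norm.1 hx, sub_self, zero_mul] at h
  simp only [sphEval, map_sub] at h ⊢
  rw [h, sub_zero]

lemma exists_poly_near_on_compact {n : ℕ} {s : Set (EuclideanSpace ℝ (Fin n))}
    (hs : IsCompact s) {f : EuclideanSpace ℝ (Fin n) → ℝ} (hf : ContinuousOn f s)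
    {δ : ℝ} (hδ : 0 < δ) : ∃ q : MvPolynomial (Fin n) ℝ, ∀ x ∈ s, |f x - sphEval q x| ≤ δ := by
  have : CompactSpace s := isCompact_iff_compactSpace.1 hs
  let c (i : Fin n) : C(s, ℝ) := ⟨fun x => (x : EuclideanSpace ℝ (Fin n)) i, by fun_prop⟩
  let Φ : MvPolynomial (Fin n) ℝ →ₐ[ℝ] C(s, ℝ) := MvPolynomial.aeval c
  have hΦ (q : MvPolynomial (Fin n) ℝ) (x : s) : Φ q x = sphEval q x := by
    induction q using MvPolynomial.induction_on with
    | C a => simp [Φ, sphEval]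
    | add p q hp hq => simpa [sphEval] using congrArg₂ (· + ·) hp hq
    | mul_X p j hp =>
      rw [map_mul, ContinuousMap.mul_apply, hp]
      simp [Φ, c, sphEval]
  obtain ⟨⟨_, q, rfl⟩, hg⟩ :=
    ContinuousMap.exists_mem_subalgebra_near_continuous_of_separatesPoints Φ.range
    (fun x y hxy => by
      obtain ⟨i, hi⟩ : ∃ i, (x : EuclideanSpace ℝ (Fin n)) i ≠
          (y : EuclideanSpace ℝ (Fin n)) i := by
        by_contra! h
        exact hxy (Subtype.ext (PiLp.ext h))
      exact ⟨_, ⟨c i, ⟨MvPolynomial.X i, by simp [Φ]⟩, rfl⟩, hi⟩)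
    (s.domRestrict f) hf.domRestrict δ hδ
  refine ⟨q, fun x hx => ?_⟩
  have := (hg ⟨x, hx⟩).le
  rw [abs_sub_comm]
  rw [Real.norm_eq_abs] at this
  exact (hΦ q ⟨x, hx⟩) ▸ this

/-- The kernel `k(r, t)` of the Vekua transform, where `r` stands for `|x|²`. -/
def vekuaKernel (r t : ℝ) : ℝ := r / 4 * besselClifford 1 (r * (t * (1 - t) / 4))

/-- The first derivative of `vekuaKernel` in `r`. -/
def vekuaKernel' (r t : ℝ) : ℝ :=
  besselClifford 1 (r * (t * (1 - t) / 4)) / 4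
    + r / 4 * (t * (1 - t) / 4) * besselClifford 2 (r * (t * (1 - t) / 4))

/-- The second derivative of `vekuaKernel` in `r`. -/
def vekuaKernel'' (r t : ℝ) : ℝ :=
  (t * (1 - t) / 4) / 2 * besselClifford 2 (r * (t * (1 - t) / 4))
    + r / 4 * (t * (1 - t) / 4) ^ 2 * besselClifford 3 (r * (t * (1 - t) / 4))

/-- The derivative of `vekuaKernel'` in `t`. -/
def vekuaKernelMixed (r t : ℝ) : ℝ :=
  r * ((1 - 2 * t) / 4) * (besselClifford 2 (r * (t * (1 - t) / 4)) / 2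
    + r / 4 * (t * (1 - t) / 4) * besselClifford 3 (r * (t * (1 - t) / 4)))

lemma hasDerivAt_besselClifford_one (z : ℝ) :
    HasDerivAt (besselClifford 1) (besselClifford 2 z) z := by
  have := hasDerivAt_besselClifford zero_le_one z
  norm_num at this
  exact this

lemma hasDerivAt_besselClifford_two (z : ℝ) :
    HasDerivAt (besselClifford 2) (besselClifford 3 z) z := by
  have := hasDerivAt_besselClifford zero_le_two z
  norm_num at this
  exact this

lemma hasDerivAt_vekuaKernel (r t : ℝ) :
    HasDerivAt (fun r => vekuaKernel r t) (vekuaKernel' r t) r := by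
  have h0 := (hasDerivAt_id r).mul_const (t * (1 - t) / 4)
  have h1 := (hasDerivAt_besselClifford_one (r * (t * (1 - t) / 4))).comp r h0
  have := ((hasDerivAt_id r).div_const 4).mul h1
  refine this.congr_deriv ?_
  simp only [vekuaKernel', Function.comp, id]
  ring

lemma hasDerivAt_vekuaKernel' (r t : ℝ) :
    HasDerivAt (fun r => vekuaKernel' r t) (vekuaKernel'' r t) r := by
  have h0 := (hasDerivAt_id r).mul_const (t * (1 - t) / 4)
  have h1 := (hasDerivAt_besselClifford_one (r * (t * (1 - t) / 4))).comp r h0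
  have h2 := (hasDerivAt_besselClifford_two (r * (t * (1 - t) / 4))).comp r h0
  have := (h1.div_const 4).add ((((hasDerivAt_id r).div_const 4).mul_const
    (t * (1 - t) / 4)).mul h2)
  refine this.congr_deriv ?_
  simp only [vekuaKernel'', Function.comp, id]
  ring

lemma hasDerivAt_vekuaKernel'_snd (r t : ℝ) :
    HasDerivAt (fun t => vekuaKernel' r t) (vekuaKernelMixed r t) t := by
  have hc : HasDerivAt (fun t : ℝ => t * (1 - t) / 4) ((1 - 2 * t) / 4) t := by
    have := ((hasDerivAt_id t).mul ((hasDerivAt_id t).const_sub 1)).div_const 4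
    refine this.congr_deriv ?_
    simp only [id]
    ring
  have h0 := hc.const_mul r
  have h1 := (hasDerivAt_besselClifford_one (r * (t * (1 - t) / 4))).comp t h0
  have h2 := (hasDerivAt_besselClifford_two (r * (t * (1 - t) / 4))).comp t h0
  have := (h1.div_const 4).add ((hc.const_mul (r / 4)).mul h2)
  refine this.congr_deriv ?_
  simp only [vekuaKernelMixed, Function.comp]
  ring

lemma vekuaKernel_pde (r t : ℝ) :
    4 * r * vekuaKernel'' r t = t ^ 2 * vekuaKernel r t + 4 * t * vekuaKernelMixed r t := by
  have h := besselClifford_recurrence zero_le_one (r * (t * (1 - t) / 4))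
  norm_num at h
  simp only [vekuaKernel'', vekuaKernel, vekuaKernelMixed]
  rw [← h]
  ring

lemma vekuaKernel'_one (r : ℝ) : vekuaKernel' r 1 = 1 / 4 := by
  have : besselClifford 1 0 = 1 := by
    rw [besselClifford, tsum_eq_single 0 (fun k hk => by simp [hk])]
    norm_num
  simp [vekuaKernel', this]

@[fun_prop]
lemma continuous_vekuaKernel : Continuous fun p : ℝ × ℝ => vekuaKernel p.1 p.2 := by
  have := continuous_besselClifford zero_le_one
  unfold vekuaKernel
  fun_prop

@[fun_prop]
lemma continuous_vekuaKernel' : Continuous fun p : ℝ × ℝ => vekuaKernel' p.1 p.2 := by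
  have := continuous_besselClifford zero_le_one
  have := continuous_besselClifford zero_le_two
  unfold vekuaKernel'
  fun_prop

@[fun_prop]
lemma continuous_vekuaKernel'' : Continuous fun p : ℝ × ℝ => vekuaKernel'' p.1 p.2 := by
  have := continuous_besselClifford zero_le_two
  have := continuous_besselClifford zero_le_three
  unfold vekuaKernel''
  fun_prop

/-- The Vekua transform, taking solutions of the Helmholtz equation to harmonic functions. -/
def vekua {n : ℕ} (ν : ℝ) (f : EuclideanSpace ℝ (Fin n) → ℝ) (x : EuclideanSpace ℝ (Fin n)) : ℝ :=
  f x + ∫ t in (0 : ℝ)..1, t ^ ν * (vekuaKernel (‖x‖ ^ 2) t * f (t • x))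

lemma continuous_vekua_integrand {n : ℕ} {ν : ℝ} (hν : 0 ≤ ν)
    {f : EuclideanSpace ℝ (Fin n) → ℝ} (hf : Continuous f) :
    Continuous fun p : EuclideanSpace ℝ (Fin n) × ℝ =>
      p.2 ^ ν * (vekuaKernel (‖p.1‖ ^ 2) p.2 * f (p.2 • p.1)) := by
  have := Real.continuous_rpow_const hν
  fun_prop

lemma intervalIntegrable_vekua_integrand {n : ℕ} {ν : ℝ} (hν : 0 ≤ ν)
    {f : EuclideanSpace ℝ (Fin n) → ℝ} (hf : Continuous f) (x : EuclideanSpace ℝ (Fin n)) :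
    IntervalIntegrable (fun t : ℝ => t ^ ν * (vekuaKernel (‖x‖ ^ 2) t * f (t • x))) volume 0 1 :=
  ((continuous_vekua_integrand hν hf).comp (by fun_prop : Continuous fun t : ℝ => (x, t))
    :).intervalIntegrable _ _

lemma continuous_vekua {n : ℕ} {ν : ℝ} (hν : 0 ≤ ν) {f : EuclideanSpace ℝ (Fin n) → ℝ}
    (hf : Continuous f) : Continuous (vekua ν f) :=
  hf.add (intervalIntegral.continuous_parametric_intervalIntegral_of_continuous'
    (continuous_vekua_integrand hν hf) 0 1)

lemma vekua_sub {n : ℕ} {ν : ℝ} (hν : 0 ≤ ν) {f g : EuclideanSpace ℝ (Fin n) → ℝ}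
    (hf : Continuous f) (hg : Continuous g) (x : EuclideanSpace ℝ (Fin n)) :
    vekua ν (fun y => f y - g y) x = vekua ν f x - vekua ν g x := by
  rw [vekua, vekua, vekua, add_sub_add_comm, ← intervalIntegral.integral_sub
    (intervalIntegrable_vekua_integrand hν hf x) (intervalIntegrable_vekua_integrand hν hg x)]
  congr 2
  ext t
  ring

lemma vekua_sum {n : ℕ} {ν : ℝ} (hν : 0 ≤ ν) {ι : Type*} (s : Finset ι)
    {f : ι → EuclideanSpace ℝ (Fin n) → ℝ} (hf : ∀ i, Continuous (f i))
    (x : EuclideanSpace ℝ (Fin n)) :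
    vekua ν (fun y => ∑ i ∈ s, f i y) x = ∑ i ∈ s, vekua ν (f i) x := by
  simp only [vekua]
  rw [Finset.sum_add_distrib, ← intervalIntegral.integral_finsetSum fun i _ =>
    intervalIntegrable_vekua_integrand hν (hf i) x]
  simp only [Finset.mul_sum]

lemma vekua_const_mul {n : ℕ} (ν c : ℝ) (f : EuclideanSpace ℝ (Fin n) → ℝ)
    (x : EuclideanSpace ℝ (Fin n)) :
    vekua ν (fun y => c * f y) x = c * vekua ν f x := by
  rw [vekua, vekua, mul_add, ← intervalIntegral.integral_const_mul]
  congr 2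
  ext t
  ring

lemma hasLineDerivAt_intervalIntegral {E : Type*} [NormedAddCommGroup E] [NormedSpace ℝ E]
    {N N' : E → ℝ → ℝ} (hN : Continuous fun p : E × ℝ => N p.1 p.2)
    (hN' : Continuous fun p : E × ℝ => N' p.1 p.2) {v : E}
    (h : ∀ x t, HasLineDerivAt ℝ (fun y => N y t) (N' x t) x v) (a b : ℝ) (x : E) :
    HasLineDerivAt ℝ (fun y => ∫ t in a..b, N y t) (∫ t in a..b, N' x t) x v := by
  obtain ⟨C, hC⟩ := ((isCompact_closedBall (0 : ℝ) 1).prod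
    (isCompact_uIcc (a := a) (b := b))).exists_bound_of_continuousOn
    (f := fun p : ℝ × ℝ => N' (x + p.1 • v) p.2)
    ((hN'.comp (by fun_prop : Continuous fun p : ℝ × ℝ => (x + p.1 • v, p.2)) :).continuousOn)
  have hc (s : ℝ) : Continuous (N (x + s • v)) :=
    hN.comp (by fun_prop : Continuous fun t : ℝ => (x + s • v, t))
  have hc' (s : ℝ) : Continuous (N' (x + s • v)) :=
    hN'.comp (by fun_prop : Continuous fun t : ℝ => (x + s • v, t))
  have := (intervalIntegral.hasDerivAt_integral_of_dominated_loc_of_deriv_le (μ := volume)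
    (F := fun s t => N (x + s • v) t) (F' := fun s t => N' (x + s • v) t) (x₀ := (0 : ℝ))
    (s := closedBall 0 1) (a := a) (b := b) (bound := fun _ => C)
    (closedBall_mem_nhds _ one_pos) (Eventually.of_forall fun s => (hc s).aestronglyMeasurable)
    ((hc 0).intervalIntegrable _ _) (hc' 0).aestronglyMeasurable
    (Eventually.of_forall fun t ht s hs => hC (s, t) ⟨hs, Set.uIoc_subset_uIcc ht⟩)
    intervalIntegrable_const
    (Eventually.of_forall fun t _ s _ => by
      have h4 := HasDerivAt.comp_sub_const s s
        (by simpa only [sub_self, HasLineDerivAt] using h (x + s • v) t)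
      simpa only [sub_smul, add_assoc, add_sub_cancel] using! h4)).2
  simpa only [zero_smul, add_zero] using! this

lemma contDiff_one_partialDeriv {n : ℕ} {f : EuclideanSpace ℝ (Fin n) → ℝ} (hf : ContDiff ℝ 2 f)
    (i : Fin n) : ContDiff ℝ 1 (partialDeriv i f) :=
  (hf.fderiv_right (m := 1) le_rfl).clm_apply contDiff_const

lemma continuous_partialDeriv_partialDeriv {n : ℕ} {f : EuclideanSpace ℝ (Fin n) → ℝ}
    (hf : ContDiff ℝ 2 f) (i : Fin n) : Continuous (partialDeriv i (partialDeriv i f)) :=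
  ((contDiff_one_partialDeriv hf i).fderiv_right (m := 0) le_rfl).continuous.clm_apply
    continuous_const

lemma hasDerivAt_comp_smul {n : ℕ} {f : EuclideanSpace ℝ (Fin n) → ℝ} (hf : Differentiable ℝ f)
    (x : EuclideanSpace ℝ (Fin n)) (t : ℝ) :
    HasDerivAt (fun t : ℝ => f (t • x)) (∑ i, x i * partialDeriv i f (t • x)) t := by
  have h := (hf (t • x)).hasFDerivAt.comp_hasDerivAt t ((hasDerivAt_id t).smul_const x)
  refine h.congr_deriv ?_
  have hx : x = ∑ i, x i • EuclideanSpace.single i (1 : ℝ) := by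
    ext j
    simp [Pi.single_apply]
  conv_lhs => rw [one_smul, hx, map_sum]
  simp only [map_smul, smul_eq_mul, partialDeriv]
  rw [← hx]

lemma exists_hasSecondPartials_vekua {n : ℕ} {ν : ℝ} (hν : 0 ≤ ν) (hnν : (n : ℝ) = 2 * (ν + 1))
    {f : EuclideanSpace ℝ (Fin n) → ℝ} (hf : ContDiff ℝ 2 f) {R : ℝ}
    (hpde : ∀ x ∈ ball (0 : EuclideanSpace ℝ (Fin n)) R, lap f x + f x = 0) :
    ∃ f₁ f₂, HasSecondPartials (vekua ν f) f₁ f₂ Set.univ ∧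
      ∀ x ∈ ball (0 : EuclideanSpace ℝ (Fin n)) R, ∑ i, f₂ i x = 0 := by
  have hN (t : ℝ) := (((HasSecondPartials.comp_normSq (U := Set.univ)
    (fun r => hasDerivAt_vekuaKernel r t) (fun r => hasDerivAt_vekuaKernel' r t)).mul
    (HasSecondPartials.comp_smul hf t))).const_mul (t ^ ν)
  have hrpow := Real.continuous_rpow_const hν
  have hfc := hf.continuous
  have hf1 (i : Fin n) := (contDiff_one_partialDeriv hf i).continuous
  have hf2 (i : Fin n) := continuous_partialDeriv_partialDeriv hf i
  have hf0 := HasSecondPartials.of_contDiff (U := Set.univ) hf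
  refine ⟨_, _, hf0.add ⟨fun x _ i => hasLineDerivAt_intervalIntegral
      (continuous_vekua_integrand hν hfc) ?_ (fun x t => (hN t).fst x trivial i) 0 1 x,
    fun x _ i => hasLineDerivAt_intervalIntegral ?_ ?_ (fun x t => (hN t).snd x trivial i)
      0 1 x⟩, fun x hx => ?_⟩
  · fun_prop
  · fun_prop
  · fun_prop
  have hball (t : ℝ) (ht : t ∈ Set.Icc (0 : ℝ) 1) :
      ∑ i, partialDeriv i (partialDeriv i f) (t • x) = - f (t • x) := by
    rw [← lap_eq_sum_partialDeriv hf, eq_neg_iff_add_eq_zero]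
    refine hpde _ ?_
    rw [mem_ball_zero_iff] at hx ⊢
    rw [norm_smul, Real.norm_of_nonneg ht.1]
    exact (mul_le_of_le_one_left (norm_nonneg x) ht.2).trans_lt hx
  rw [Finset.sum_add_distrib, ← intervalIntegral.integral_finsetSum]
  swap
  · intro i _
    refine Continuous.intervalIntegrable ?_ _ _
    fun_prop
  have hd : ∀ t ∈ Set.uIcc (0 : ℝ) 1, HasDerivAt
      (fun t : ℝ => 4 * t ^ (ν + 1) * (vekuaKernel' (‖x‖ ^ 2) t * f (t • x)))
      (∑ i, t ^ ν * ((2 * vekuaKernel' (‖x‖ ^ 2) t + 4 * x i ^ 2 * vekuaKernel'' (‖x‖ ^ 2) t)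
          * f (t • x) + 2 * (2 * x i * vekuaKernel' (‖x‖ ^ 2) t * (t * partialDeriv i f (t • x)))
        + vekuaKernel (‖x‖ ^ 2) t * (t ^ 2 * partialDeriv i (partialDeriv i f) (t • x)))) t := by
    intro t ht
    rw [Set.uIcc_of_le zero_le_one] at ht
    have h1 := (Real.hasDerivAt_rpow_const (x := t) (p := ν + 1)
      (Or.inr (by linarith))).const_mul 4
    have h2 := (hasDerivAt_vekuaKernel'_snd (‖x‖ ^ 2) t).mul
      (hasDerivAt_comp_smul (hf.differentiable (by norm_num)) x t)
    refine (h1.mul h2).congr_deriv ?_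
    simp only [Pi.mul_apply]
    have hp := vekuaKernel_pde (‖x‖ ^ 2) t
    have hb := hball t ht
    rw [Real.rpow_add_one' ht.1 (by linarith), add_sub_cancel_right]
    set a := vekuaKernel (‖x‖ ^ 2) t
    set a' := vekuaKernel' (‖x‖ ^ 2) t
    set a'' := vekuaKernel'' (‖x‖ ^ 2) t
    have e : ∀ i, t ^ ν * ((2 * a' + 4 * x i ^ 2 * a'') * f (t • x)
        + 2 * (2 * x i * a' * (t * partialDeriv i f (t • x)))
        + a * (t ^ 2 * partialDeriv i (partialDeriv i f) (t • x)))
        = t ^ ν * (2 * a' * f (t • x)) + t ^ ν * 4 * a'' * f (t • x) * x i ^ 2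
          + t ^ ν * 4 * a' * t * (x i * partialDeriv i f (t • x))
          + t ^ ν * a * t ^ 2 * partialDeriv i (partialDeriv i f) (t • x) := fun i => by ring
    simp only [e, Finset.sum_add_distrib, ← Finset.mul_sum, hb, ← EuclideanSpace.real_norm_sq_eq,
      Finset.sum_const, Finset.card_univ, Fintype.card_fin, nsmul_eq_mul, hnν]
    linear_combination (-t ^ ν * f (t • x)) * hp
  rw [intervalIntegral.integral_eq_sub_of_hasDerivAt hd]
  swap
  · refine Continuous.intervalIntegrable ?_ _ _
    fun_prop
  rw [vekuaKernel'_one, Real.zero_rpow (by linarith)]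
  have := hball 1 (by simp)
  simp only [one_smul, Real.one_rpow] at this ⊢
  rw [this]
  ring

lemma exists_abs_vekuaKernel_le (R : ℝ) : ∃ A, 0 ≤ A ∧
    ∀ r ∈ Set.Icc 0 R, ∀ t ∈ Set.Icc (0 : ℝ) 1, |vekuaKernel (r ^ 2) t| ≤ A * r := by
  obtain ⟨B, hB⟩ := (isCompact_Icc (a := (0 : ℝ)) (b := R)).prod
    (isCompact_Icc (a := (0 : ℝ)) (b := 1)) |>.exists_bound_of_continuousOn
    (f := fun p : ℝ × ℝ => p.1 / 4 * besselClifford 1 (p.1 ^ 2 * (p.2 * (1 - p.2) / 4)))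
    (by
      have := continuous_besselClifford zero_le_one
      fun_prop)
  refine ⟨|B|, abs_nonneg B, fun r hr t ht => ?_⟩
  have h := hB (r, t) ⟨hr, ht⟩
  have e : vekuaKernel (r ^ 2) t
      = r / 4 * besselClifford 1 (r ^ 2 * (t * (1 - t) / 4)) * r := by
    rw [vekuaKernel]; ring
  rw [e, abs_mul, abs_of_nonneg hr.1]
  exact mul_le_mul_of_nonneg_right (h.trans (le_abs_self B)) hr.1

lemma integral_mul_exp_mul (a : ℝ) : ∫ t in (0 : ℝ)..1, a * Real.exp (a * t) = Real.exp a - 1 := by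
  rw [intervalIntegral.integral_eq_sub_of_hasDerivAt (f := fun t => Real.exp (a * t))]
  · simp
  · intro t _
    exact (((hasDerivAt_id t).const_mul a).exp).congr_deriv (by simp [mul_comm])
  · exact Continuous.intervalIntegrable (by fun_prop) _ _

/-- The Vekua transform is a Volterra operator along rays, hence boundedly invertible. -/
lemma exists_abs_le_of_abs_vekua_le (n : ℕ) {ν : ℝ} (hν : 0 ≤ ν) {R : ℝ} (hR : 0 ≤ R) :
    ∃ C, 0 < C ∧ ∀ u : EuclideanSpace ℝ (Fin n) → ℝ, Continuous u → ∀ δ,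
      (∀ x ∈ closedBall (0 : EuclideanSpace ℝ (Fin n)) R, |vekua ν u x| ≤ δ) →
      ∀ x ∈ closedBall (0 : EuclideanSpace ℝ (Fin n)) R, |u x| ≤ C * δ := by
  obtain ⟨A, hA, hk⟩ := exists_abs_vekuaKernel_le R
  set L := 2 * A + 1 with hL
  have hL0 : 0 < L := by positivity
  refine ⟨2 * Real.exp (L * R), by positivity, fun u hu δ hδ x hx => ?_⟩
  have h0 : (0 : EuclideanSpace ℝ (Fin n)) ∈ closedBall 0 R := mem_closedBall_self hR
  have hδ0 : 0 ≤ δ := (abs_nonneg _).trans (hδ 0 h0)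
  obtain ⟨y, hy, hmax⟩ := (isCompact_closedBall (0 : EuclideanSpace ℝ (Fin n)) R).exists_isMaxOn
    ⟨0, h0⟩ (f := fun x => Real.exp (-(L * ‖x‖)) * |u x|) (by fun_prop)
  set M := Real.exp (-(L * ‖y‖)) * |u y| with hM
  have hM0 : 0 ≤ M := by positivity
  have hu_le (z) (hz : z ∈ closedBall (0 : EuclideanSpace ℝ (Fin n)) R) :
      |u z| ≤ M * Real.exp (L * ‖z‖) := by
    have : Real.exp (-(L * ‖z‖)) * |u z| ≤ M := hmax hz
    rwa [Real.exp_neg, inv_mul_le_iff₀ (Real.exp_pos _), mul_comm] at this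
  rw [mem_closedBall_zero_iff] at hy
  have hint : |∫ t in (0 : ℝ)..1, t ^ ν * (vekuaKernel (‖y‖ ^ 2) t * u (t • y))|
      ≤ A / L * M * (Real.exp (L * ‖y‖) - 1) := by
    rw [← integral_mul_exp_mul, ← intervalIntegral.integral_const_mul]
    rw [← Real.norm_eq_abs]
    refine intervalIntegral.norm_integral_le_of_norm_le (μ := volume)
      (g := fun t => A / L * M * (L * ‖y‖ * Real.exp (L * ‖y‖ * t))) zero_le_one
      (Eventually.of_forall ?_) (Continuous.intervalIntegrable (by fun_prop) _ _)
    intro t ht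
    have ht' : t ∈ Set.Icc (0 : ℝ) 1 := Set.Ioc_subset_Icc_self ht
    have hty : ‖t • y‖ = t * ‖y‖ := by rw [norm_smul, Real.norm_of_nonneg ht'.1]
    have h1 := hk ‖y‖ ⟨norm_nonneg y, hy⟩ t ht'
    have h2 := hu_le (t • y) (by
      rw [mem_closedBall_zero_iff, hty]
      exact (mul_le_of_le_one_left (norm_nonneg y) ht'.2).trans hy)
    have h3 : |t ^ ν| ≤ 1 := by
      rw [abs_of_nonneg (Real.rpow_nonneg ht'.1 _)]
      exact Real.rpow_le_one ht'.1 ht'.2 hν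
    rw [Real.norm_eq_abs, abs_mul, abs_mul]
    calc |t ^ ν| * (|vekuaKernel (‖y‖ ^ 2) t| * |u (t • y)|)
        ≤ 1 * ((A * ‖y‖) * (M * Real.exp (L * ‖t • y‖))) := by gcongr
      _ = A / L * M * (L * ‖y‖ * Real.exp (L * ‖y‖ * t)) := by
        rw [hty, show L * (t * ‖y‖) = L * ‖y‖ * t by ring]
        field_simp
  have hAL : A / L ≤ 1 / 2 := by
    rw [div_le_div_iff₀ hL0 two_pos]; linarith
  have huy : |u y| ≤ δ + M / 2 * Real.exp (L * ‖y‖) := by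
    have h1 := hδ y (mem_closedBall_zero_iff.2 hy)
    have h2 : u y = vekua ν u y
        - ∫ t in (0 : ℝ)..1, t ^ ν * (vekuaKernel (‖y‖ ^ 2) t * u (t • y)) := by
      rw [vekua]; ring
    have hexp : 1 ≤ Real.exp (L * ‖y‖) := Real.one_le_exp (by positivity)
    have h3 : A / L * M * (Real.exp (L * ‖y‖) - 1) ≤ 1 / 2 * M * (Real.exp (L * ‖y‖)) := by
      have : Real.exp (L * ‖y‖) - 1 ≤ Real.exp (L * ‖y‖) := by linarith
      gcongr
    rw [h2]
    exact (abs_sub _ _).trans (by linarith)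
  have hM2 : M ≤ 2 * δ := by
    have h1 : M ≤ Real.exp (-(L * ‖y‖)) * (δ + M / 2 * Real.exp (L * ‖y‖)) :=
      mul_le_mul_of_nonneg_left huy (Real.exp_pos _).le
    have h2 : Real.exp (-(L * ‖y‖)) * Real.exp (L * ‖y‖) = 1 := by
      rw [← Real.exp_add]; simp
    have h3 : Real.exp (-(L * ‖y‖)) * δ ≤ δ :=
      mul_le_of_le_one_left hδ0 (Real.exp_le_one_iff.2 (by
        rw [neg_nonpos]; positivity))
    have h4 : Real.exp (-(L * ‖y‖)) * (δ + M / 2 * Real.exp (L * ‖y‖))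
      = Real.exp (-(L * ‖y‖)) * δ + M / 2 := by
      linear_combination (M / 2) * h2
    linarith
  have hxR := mem_closedBall_zero_iff.1 hx
  calc |u x| ≤ M * Real.exp (L * ‖x‖) := hu_le x hx
    _ ≤ 2 * δ * Real.exp (L * R) := by gcongr
    _ = 2 * Real.exp (L * R) * δ := by ring

lemma sphEval_smul {n ℓ : ℕ} {P : MvPolynomial (Fin n) ℝ} (hP : P.IsHomogeneous ℓ) (t : ℝ)
    (x : EuclideanSpace ℝ (Fin n)) : sphEval P (t • x) = t ^ ℓ * sphEval P x := by
  rw [sphEval, sphEval, MvPolynomial.eval_eq', MvPolynomial.eval_eq', Finset.mul_sum]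
  refine Finset.sum_congr rfl fun d hd => ?_
  have h : ∑ i, d i = ℓ := by
    rw [← hP (MvPolynomial.mem_support_iff.1 hd), ← Finsupp.degree_eq_sum]
    exact DFunLike.congr_fun Finsupp.degree_eq_weight_one d
  simp only [PiLp.smul_apply, smul_eq_mul, mul_pow, Finset.prod_mul_distrib]
  rw [Finset.prod_pow_eq_pow_sum, h]
  ring

/-- The regular solution of the Helmholtz equation built from the homogeneous polynomial `P`. -/
def besselMode {n : ℕ} (μ : ℝ) (P : MvPolynomial (Fin n) ℝ) (x : EuclideanSpace ℝ (Fin n)) : ℝ :=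
  sphEval P x * besselClifford μ (-‖x‖ ^ 2 / 4)

lemma contDiff_besselMode {n : ℕ} {μ : ℝ} (hμ : 0 ≤ μ) (P : MvPolynomial (Fin n) ℝ) :
    ContDiff ℝ (⊤ : ℕ∞) (besselMode μ P) :=
  (contDiff_sphEval P).mul ((contDiff_besselClifford hμ).comp
    ((contDiff_norm_sq ℝ).neg.div_const 4))

lemma sum_mul_sphEval_pderiv {n ℓ : ℕ} {P : MvPolynomial (Fin n) ℝ} (hP : P.IsHomogeneous ℓ)
    (x : EuclideanSpace ℝ (Fin n)) :
    ∑ i, x i * sphEval (MvPolynomial.pderiv i P) x = ℓ * sphEval P x := by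
  have := congrArg (fun p => sphEval p x) hP.sum_X_mul_pderiv
  simpa [sphEval] using this

lemma lap_besselMode {n ℓ : ℕ} {ν : ℝ} (hν : 0 ≤ ν) (hnν : (n : ℝ) = 2 * (ν + 1))
    {P : MvPolynomial (Fin n) ℝ} (hP : P.IsHomogeneous ℓ) (hlap : mvLap n P = 0)
    (x : EuclideanSpace ℝ (Fin n)) :
    lap (besselMode (ℓ + ν) P) x + besselMode (ℓ + ν) P x = 0 := by
  have hμ : 0 ≤ (ℓ : ℝ) + ν := by positivity
  have hψ (r : ℝ) : HasDerivAt (fun r => besselClifford (ℓ + ν) (-r / 4))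
      (-1 / 4 * besselClifford (ℓ + ν + 1) (-r / 4)) r := by
    have := (hasDerivAt_besselClifford hμ (-r / 4)).comp r ((hasDerivAt_id r).neg.div_const 4)
    exact this.congr_deriv (by ring)
  have hψ' (r : ℝ) : HasDerivAt (fun r => -1 / 4 * besselClifford (ℓ + ν + 1) (-r / 4))
      (1 / 16 * besselClifford (ℓ + ν + 2) (-r / 4)) r := by
    have := ((hasDerivAt_besselClifford (μ := ℓ + ν + 1) (by positivity) (-r / 4)).comp r
      ((hasDerivAt_id r).neg.div_const 4)).const_mul (-1 / 4)
    refine this.congr_deriv ?_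
    rw [show (ℓ : ℝ) + ν + 1 + 1 = ℓ + ν + 2 by ring]
    ring
  have h := (hasSecondPartials_sphEval P Set.univ).mul
    (HasSecondPartials.comp_normSq (U := Set.univ) hψ hψ')
  have hrec := besselClifford_recurrence hμ (-‖x‖ ^ 2 / 4)
  have hE := sum_mul_sphEval_pderiv hP x
  have hL := sum_sphEval_pderiv P x
  rw [hlap] at hL
  rw [lap_eq_sum_of_hasSecondPartials (contDiff_besselMode hμ P).two_of_infty h x, besselMode]
  set F0 := besselClifford (ℓ + ν) (-‖x‖ ^ 2 / 4)
  set F1 := besselClifford (ℓ + ν + 1) (-‖x‖ ^ 2 / 4)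
  set F2 := besselClifford (ℓ + ν + 2) (-‖x‖ ^ 2 / 4)
  have e : ∀ i, sphEval (MvPolynomial.pderiv i (MvPolynomial.pderiv i P)) x * F0
      + 2 * (sphEval (MvPolynomial.pderiv i P) x * (2 * x i * (-1 / 4 * F1)))
      + sphEval P x * (2 * (-1 / 4 * F1) + 4 * x i ^ 2 * (1 / 16 * F2))
      = F0 * sphEval (MvPolynomial.pderiv i (MvPolynomial.pderiv i P)) x
        + (-F1) * (x i * sphEval (MvPolynomial.pderiv i P) x)
        + (sphEval P x * F2 / 4) * x i ^ 2 + -(sphEval P x * F1 / 2) := fun i => by ring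
  simp only [e, Finset.sum_add_distrib, ← Finset.mul_sum, hE, hL,
    ← EuclideanSpace.real_norm_sq_eq, Finset.sum_const, Finset.card_univ, Fintype.card_fin,
    nsmul_eq_mul, hnν]
  rw [show sphEval (0 : MvPolynomial (Fin n) ℝ) x = 0 by simp [sphEval]]
  linear_combination (-sphEval P x) * hrec

lemma vekua_besselMode {n ℓ : ℕ} {ν μ : ℝ} {P : MvPolynomial (Fin n) ℝ}
    (hP : P.IsHomogeneous ℓ) : ∃ w : ℝ → ℝ, ∀ x, vekua ν (besselMode μ P) x
      = sphEval P x * w ‖x‖ := by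
  refine ⟨fun r => besselClifford μ (-r ^ 2 / 4) + ∫ t in (0 : ℝ)..1, t ^ ν *
    (vekuaKernel (r ^ 2) t * (t ^ ℓ * besselClifford μ (-(|t| * r) ^ 2 / 4))), fun x => ?_⟩
  rw [vekua, mul_add, ← intervalIntegral.integral_const_mul]
  congr 2
  ext t
  rw [besselMode, sphEval_smul hP, norm_smul, Real.norm_eq_abs]
  ring

lemma exists_vekua_besselMode_eq {n ℓ : ℕ} (hn : 0 < n) {ν : ℝ} (hν : 0 ≤ ν)
    (hnν : (n : ℝ) = 2 * (ν + 1)) {R : ℝ} {P : MvPolynomial (Fin n) ℝ}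
    (hP : P.IsHomogeneous ℓ) (hlap : mvLap n P = 0) :
    ∃ c : ℝ, ∀ x ∈ closedBall (0 : EuclideanSpace ℝ (Fin n)) R,
      vekua ν (besselMode (ℓ + ν) P) x = c * sphEval P x := by
  have hμ : 0 ≤ (ℓ : ℝ) + ν := by positivity
  have hu := contDiff_besselMode hμ P
  obtain ⟨w, hw⟩ := vekua_besselMode (ν := ν) (μ := ℓ + ν) hP
  obtain ⟨f₁, f₂, hf, hf0⟩ := exists_hasSecondPartials_vekua hν hnν hu.two_of_infty
    (R := R) (fun x _ => lap_besselMode hν hnν hP hlap x)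
  refine ⟨w R, fun x hx => ?_⟩
  have hd := (hf.mono (Set.subset_univ (ball 0 R))).add
    ((hasSecondPartials_sphEval P (ball 0 R)).const_mul (-w R))
  have := hd.abs_le_of_abs_le_on_sphere (M := 0) hn
    ((continuous_vekua hν hu.continuous).add
      (continuous_const.mul (contDiff_sphEval P).continuous)).continuousOn
    (fun x hx => by
      rw [Finset.sum_add_distrib, hf0 x hx, ← Finset.mul_sum, sum_sphEval_pderiv, hlap]
      simp [sphEval])
    (fun x hx => by
      rw [hw, mem_sphere_zero_iff_norm.1 hx]
      simp [mul_comm]) hx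
  have := abs_nonpos_iff.1 this
  linarith

lemma eq_zero_of_vekua_besselMode_eq_zero {n : ℕ} {ν μ : ℝ} (hν : 0 ≤ ν) (hμ : 0 ≤ μ) {R : ℝ}
    (hR : 0 < R) {P : MvPolynomial (Fin n) ℝ}
    (h : ∀ x ∈ closedBall (0 : EuclideanSpace ℝ (Fin n)) R,
      vekua ν (besselMode μ P) x = 0) : P = 0 := by
  obtain ⟨C, -, hC⟩ := exists_abs_le_of_abs_vekua_le n hν hR.le
  have h0 := hC _ (contDiff_besselMode hμ P).continuous 0 fun x hx => by simp [h x hx]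
  have hc : Continuous fun x : EuclideanSpace ℝ (Fin n) => besselClifford μ (-‖x‖ ^ 2 / 4) :=
    (continuous_besselClifford hμ).comp (by fun_prop)
  have hev : ∀ᶠ x in nhds (0 : EuclideanSpace ℝ (Fin n)),
      0 < besselClifford μ (-‖x‖ ^ 2 / 4) :=
    hc.continuousAt.eventually (lt_mem_nhds (by simpa using besselClifford_zero_pos hμ))
  obtain ⟨δ, hδ, hball⟩ := Metric.eventually_nhds_iff.1 hev
  refine eq_zero_of_sphEval_eq_zero_on_ball (lt_min hδ hR) fun x hx => ?_
  rw [mem_ball_zero_iff, lt_min_iff] at hx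
  have h1 := h0 x (mem_closedBall_zero_iff.2 hx.2.le)
  rw [mul_zero, abs_nonpos_iff, besselMode] at h1
  exact (mul_eq_zero.1 h1).resolve_right
    (ne_of_gt (hball (y := x) (by rw [dist_zero_right]; exact hx.1)))

/-- Uniform approximation of Helmholtz solutions by Bessel modes, without derivatives. -/
lemma exists_besselMode_sum_near {n : ℕ} (hn : 0 < n) {ν : ℝ} (hν : 0 ≤ ν)
    (hnν : (n : ℝ) = 2 * (ν + 1)) {R : ℝ} (hR : 0 < R) {g : EuclideanSpace ℝ (Fin n) → ℝ}
    (hg : ContDiff ℝ 2 g)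
    (hpde : ∀ x ∈ ball (0 : EuclideanSpace ℝ (Fin n)) R, lap g x + g x = 0)
    {ε : ℝ} (hε : 0 < ε) :
    ∃ (d : ℕ) (P : ℕ → MvPolynomial (Fin n) ℝ),
      (∀ ℓ, (P ℓ).IsHomogeneous ℓ ∧ mvLap n (P ℓ) = 0) ∧
      ∀ x ∈ closedBall (0 : EuclideanSpace ℝ (Fin n)) R,
        |g x - ∑ ℓ ∈ Finset.range d, besselMode (ℓ + ν) (P ℓ) x| ≤ ε := by
  obtain ⟨C, hC, hinv⟩ := exists_abs_le_of_abs_vekua_le n hν hR.le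
  obtain ⟨f₁, f₂, hf, hf0⟩ := exists_hasSecondPartials_vekua hν hnν hg hpde
  have hvc := continuous_vekua hν hg.continuous
  obtain ⟨q, hq⟩ := exists_poly_near_on_compact
    (isCompact_sphere (0 : EuclideanSpace ℝ (Fin n)) R) hvc.continuousOn
    (δ := ε / C) (by positivity)
  obtain ⟨H, hH0, hH⟩ := exists_harmonic_poly_eq_on_sphere hn hR q
  have hnear : ∀ x ∈ closedBall (0 : EuclideanSpace ℝ (Fin n)) R,
      |vekua ν g x + -1 * sphEval H x| ≤ ε / C := fun x hx => by
    refine ((hf.mono (Set.subset_univ (ball 0 R))).add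
      ((hasSecondPartials_sphEval H (ball 0 R)).const_mul (-1))).abs_le_of_abs_le_on_sphere hn
      (hvc.add (continuous_const.mul (contDiff_sphEval H).continuous)).continuousOn
      (fun x hx => ?_) (fun x hx => ?_) hx
    · rw [Finset.sum_add_distrib, hf0 x hx, ← Finset.mul_sum, sum_sphEval_pderiv, hH0]
      simp [sphEval]
    · rw [hH x hx, neg_one_mul, ← sub_eq_add_neg]
      exact hq x hx
  set Hc : ℕ → MvPolynomial (Fin n) ℝ := fun ℓ => MvPolynomial.homogeneousComponent ℓ H
  have hHc (ℓ : ℕ) : (Hc ℓ).IsHomogeneous ℓ :=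
    MvPolynomial.homogeneousComponent_isHomogeneous ℓ H
  have hHl (ℓ : ℕ) : mvLap n (Hc ℓ) = 0 := mvLap_homogeneousComponent hH0 ℓ
  choose c hc using fun ℓ => exists_vekua_besselMode_eq hn hν hnν (R := R) (hHc ℓ) (hHl ℓ)
  have hμ (ℓ : ℕ) : 0 ≤ (ℓ : ℝ) + ν := by positivity
  have hmode (ℓ : ℕ) (a : ℝ) (x : EuclideanSpace ℝ (Fin n)) :
      besselMode (ℓ + ν) (MvPolynomial.C a * Hc ℓ) x = a * besselMode (ℓ + ν) (Hc ℓ) x := by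
    simp [besselMode, sphEval, mul_assoc]
  have hcP (ℓ : ℕ) (x) (hx : x ∈ closedBall (0 : EuclideanSpace ℝ (Fin n)) R) :
      (c ℓ)⁻¹ * vekua ν (besselMode (ℓ + ν) (Hc ℓ)) x = sphEval (Hc ℓ) x := by
    by_cases h0 : c ℓ = 0
    · have : Hc ℓ = 0 := eq_zero_of_vekua_besselMode_eq_zero hν (hμ ℓ) hR
        fun x hx => by rw [hc ℓ x hx, h0, zero_mul]
      rw [this, h0]
      simp [sphEval]
    · rw [hc ℓ x hx, inv_mul_cancel_left₀ h0]
  refine ⟨H.totalDegree + 1, fun ℓ => MvPolynomial.C (c ℓ)⁻¹ * Hc ℓ, fun ℓ => ⟨?_, ?_⟩, ?_⟩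
  · simpa using (MvPolynomial.isHomogeneous_C (Fin n) (c ℓ)⁻¹).mul (hHc ℓ)
  · beta_reduce
    rw [MvPolynomial.C_mul', map_smul, hHl, smul_zero]
  simp only [hmode]
  have hmc (ℓ : ℕ) : Continuous fun x => (c ℓ)⁻¹ * besselMode (ℓ + ν) (Hc ℓ) x :=
    continuous_const.mul (contDiff_besselMode (hμ ℓ) (Hc ℓ)).continuous
  have hsc := continuous_finsetSum (Finset.range (H.totalDegree + 1)) fun ℓ _ => hmc ℓ
  intro x hx
  have := hinv _ (hg.continuous.sub hsc) (ε / C) (fun x hx => ?_) x hx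
  · rwa [mul_div_cancel₀ _ hC.ne'] at this
  · refine le_trans (le_of_eq ?_) (hnear x hx)
    refine (congrArg _ (vekua_sub hν hg.continuous hsc x)).trans ?_
    rw [vekua_sum hν _ hmc]
    simp only [vekua_const_mul, hcP _ x hx]
    rw [neg_one_mul, ← sub_eq_add_neg]
    congr 2
    conv_rhs => rw [← MvPolynomial.sum_homogeneousComponent H]
    simp [sphEval, Hc]

/-- Smooth solutions of the Helmholtz equation `Δu + u = 0` on the whole space. -/
structure IsHelmholtz {n : ℕ} (u : EuclideanSpace ℝ (Fin n) → ℝ) : Prop where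
  contDiff : ContDiff ℝ (⊤ : ℕ∞) u
  sum_partialDeriv : ∀ x, ∑ i, partialDeriv i (partialDeriv i u) x = -u x

lemma contDiff_partialDeriv {n : ℕ} {f : EuclideanSpace ℝ (Fin n) → ℝ}
    (hf : ContDiff ℝ (⊤ : ℕ∞) f) (i : Fin n) : ContDiff ℝ (⊤ : ℕ∞) (partialDeriv i f) :=
  (hf.fderiv_right (m := (⊤ : ℕ∞)) le_rfl).clm_apply contDiff_const

lemma partialDeriv_comm {n : ℕ} {f : EuclideanSpace ℝ (Fin n) → ℝ} (hf : ContDiff ℝ 2 f)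
    (i j : Fin n) : partialDeriv i (partialDeriv j f) = partialDeriv j (partialDeriv i f) := by
  have hd : Differentiable ℝ (fderiv ℝ f) :=
    (hf.fderiv_right (m := 1) le_rfl).differentiable one_ne_zero
  have key (i j : Fin n) (x : EuclideanSpace ℝ (Fin n)) : partialDeriv i (partialDeriv j f) x
      = fderiv ℝ (fderiv ℝ f) x (EuclideanSpace.single i 1) (EuclideanSpace.single j 1) := by
    have : HasFDerivAt (partialDeriv j f) _ x :=
      (hd x).hasFDerivAt.clm_apply (hasFDerivAt_const (EuclideanSpace.single j (1 : ℝ)) x)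
    rw [partialDeriv, this.fderiv]
    simp
  ext x
  rw [key, key]
  exact (hf.contDiffAt.isSymmSndFDerivAt (by simp)) _ _

lemma partialDeriv_sub {n : ℕ} {f g : EuclideanSpace ℝ (Fin n) → ℝ} (hf : Differentiable ℝ f)
    (hg : Differentiable ℝ g) (i : Fin n) :
    partialDeriv i (fun x => f x - g x) = fun x => partialDeriv i f x - partialDeriv i g x := by
  ext x
  rw [partialDeriv, fderiv_fun_sub (hf x) (hg x)]
  rfl

lemma partialDeriv_neg {n : ℕ} (f : EuclideanSpace ℝ (Fin n) → ℝ) (i : Fin n) :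
    partialDeriv i (fun x => -f x) = fun x => -partialDeriv i f x := by
  ext x
  rw [partialDeriv, fderiv_fun_neg]
  rfl

lemma partialDeriv_sum {n : ℕ} {ι : Type*} (s : Finset ι) {f : ι → EuclideanSpace ℝ (Fin n) → ℝ}
    (hf : ∀ j, Differentiable ℝ (f j)) (i : Fin n) :
    partialDeriv i (fun x => ∑ j ∈ s, f j x) = fun x => ∑ j ∈ s, partialDeriv i (f j) x := by
  ext x
  rw [partialDeriv, fderiv_fun_sum fun j _ => hf j x]
  simp [partialDeriv]

namespace IsHelmholtz

variable {n : ℕ} {u v : EuclideanSpace ℝ (Fin n) → ℝ}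

lemma sub (hu : IsHelmholtz u) (hv : IsHelmholtz v) : IsHelmholtz fun x => u x - v x := by
  refine ⟨hu.contDiff.sub hv.contDiff, fun x => ?_⟩
  have h (i : Fin n) : partialDeriv i (partialDeriv i fun x => u x - v x) x
      = partialDeriv i (partialDeriv i u) x - partialDeriv i (partialDeriv i v) x := by
    rw [partialDeriv_sub (hu.contDiff.differentiable (by simp))
      (hv.contDiff.differentiable (by simp)), partialDeriv_sub
      ((contDiff_partialDeriv hu.contDiff i).differentiable (by simp))
      ((contDiff_partialDeriv hv.contDiff i).differentiable (by simp))]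
  simp only [h, Finset.sum_sub_distrib, hu.sum_partialDeriv, hv.sum_partialDeriv]
  ring

lemma sum {ι : Type*} (s : Finset ι) {u : ι → EuclideanSpace ℝ (Fin n) → ℝ}
    (hu : ∀ j, IsHelmholtz (u j)) : IsHelmholtz fun x => ∑ j ∈ s, u j x := by
  refine ⟨ContDiff.sum fun j _ => (hu j).contDiff, fun x => ?_⟩
  have h (i : Fin n) : partialDeriv i (partialDeriv i fun x => ∑ j ∈ s, u j x) x
      = ∑ j ∈ s, partialDeriv i (partialDeriv i (u j)) x := by
    rw [partialDeriv_sum s fun j => (hu j).contDiff.differentiable (by simp), partialDeriv_sum s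
      fun j => (contDiff_partialDeriv (hu j).contDiff i).differentiable (by simp)]
  simp only [h]
  rw [Finset.sum_comm]
  simp only [(hu _).sum_partialDeriv, Finset.sum_neg_distrib]

protected lemma partialDeriv (hu : IsHelmholtz u) (k : Fin n) :
    IsHelmholtz (partialDeriv k u) := by
  refine ⟨contDiff_partialDeriv hu.contDiff k, fun x => ?_⟩
  have h (i : Fin n) : partialDeriv i (partialDeriv i (partialDeriv k u))
      = partialDeriv k (partialDeriv i (partialDeriv i u)) := by
    rw [partialDeriv_comm hu.contDiff.two_of_infty i k,
      partialDeriv_comm (contDiff_partialDeriv hu.contDiff i).two_of_infty i k]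
  simp only [h]
  have h2 := congrFun (partialDeriv_sum Finset.univ (fun i => (contDiff_partialDeriv
    (contDiff_partialDeriv hu.contDiff i) i).differentiable (by simp)) k) x
  rw [← h2]
  simp only [hu.sum_partialDeriv]
  rw [partialDeriv_neg]

lemma of_lap (hu : ContDiff ℝ (⊤ : ℕ∞) u) (h : ∀ x, lap u x + u x = 0) : IsHelmholtz u :=
  ⟨hu, fun x => by
    rw [← lap_eq_sum_partialDeriv hu.two_of_infty]; linarith [h x]⟩

/-- Bernstein-type interior gradient estimate. -/
lemma sq_partialDeriv_le (hn : 0 < n) (hu : IsHelmholtz u) {R M : ℝ}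
    (hM : ∀ x ∈ closedBall (0 : EuclideanSpace ℝ (Fin n)) R, |u x| ≤ M) (k : Fin n)
    {x : EuclideanSpace ℝ (Fin n)} (hx : x ∈ closedBall (0 : EuclideanSpace ℝ (Fin n)) R) :
    ((R ^ 2 - ‖x‖ ^ 2) * partialDeriv k u x) ^ 2
      ≤ (12 * R ^ 2 + 2 * n * R ^ 2 + R ^ 4) * (1 + R ^ 2) * M ^ 2 := by
  set L := 12 * R ^ 2 + 2 * n * R ^ 2 + R ^ 4 with hL
  have hL0 : 0 ≤ L := by positivity
  have hv := hu.partialDeriv k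
  have hu2 (x) (hx : x ∈ closedBall (0 : EuclideanSpace ℝ (Fin n)) R) : u x * u x ≤ M ^ 2 := by
    rw [← sq]
    exact sq_le_sq' (by linarith [abs_le.1 (hM x hx)]) (abs_le.1 (hM x hx)).2
  have sv := HasSecondPartials.of_contDiff (U := ball 0 R) hv.contDiff.two_of_infty
  have su := HasSecondPartials.of_contDiff (U := ball 0 R) hu.contDiff.two_of_infty
  have sχ := (HasSecondPartials.const (n := n) (U := ball 0 R) (R ^ 2)).add
    ((HasSecondPartials.normSq (n := n) (U := ball 0 R)).const_mul (-1))
  have sy := sχ.mul sv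
  have sw := (sy.mul sy).add (((su.mul su).const_mul L).add
    ((HasSecondPartials.normSq (n := n) (U := ball 0 R)).const_mul (L * M ^ 2)))
  have hcu := hu.contDiff.continuous
  have hcv := hv.contDiff.continuous
  have key := sw.le_of_le_on_sphere hn (M := L * (1 + R ^ 2) * M ^ 2)
    (Continuous.continuousOn (by fun_prop)) (fun x hx => ?_) (fun x hx => ?_) hx
  · refine le_trans ?_ key
    have h1 : 0 ≤ L * (u x * u x) := mul_nonneg hL0 (mul_self_nonneg _)
    have h2 : 0 ≤ L * M ^ 2 * ‖x‖ ^ 2 := by positivity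
    linarith
  · have hb := hv.sum_partialDeriv x
    have hq := hu.sum_partialDeriv x
    have hxR : ‖x‖ ^ 2 ≤ R ^ 2 := by
      have := mem_ball_zero_iff.1 hx
      gcongr
    set χ := R ^ 2 + -1 * ‖x‖ ^ 2 with hχ
    set V := partialDeriv k u x
    have hp : V ^ 2 ≤ ∑ i, partialDeriv i u x ^ 2 :=
      Finset.single_le_sum (f := fun i => partialDeriv i u x ^ 2) (fun i _ => sq_nonneg _)
        (Finset.mem_univ k)
    have hlow : 0 ≤ ∑ i, ((-24 * V ^ 2) * x i ^ 2 + -(4 * χ * V ^ 2)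
        + (2 * χ ^ 2 * V) * partialDeriv i (partialDeriv i (partialDeriv k u)) x
        + (2 * L * u x) * partialDeriv i (partialDeriv i u) x
        + (2 * L) * partialDeriv i u x ^ 2 + 2 * L * M ^ 2) := by
      simp only [Finset.sum_add_distrib, ← Finset.mul_sum, hb, hq,
        ← EuclideanSpace.real_norm_sq_eq, Finset.sum_const, Finset.card_univ, Fintype.card_fin,
        nsmul_eq_mul]
      have hn1 : (1 : ℝ) ≤ n := by exact_mod_cast hn
      have h1 : 0 ≤ V ^ 2 * (24 * (R ^ 2 - ‖x‖ ^ 2) + 4 * n * ‖x‖ ^ 2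
          + 2 * ‖x‖ ^ 2 * (R ^ 2 - ‖x‖ ^ 2) + 2 * ‖x‖ ^ 2 * R ^ 2) := by
        have := sub_nonneg.2 hxR
        positivity
      have h2 : 0 ≤ 2 * L * (∑ i, partialDeriv i u x ^ 2 - V ^ 2) :=
        mul_nonneg (by positivity) (sub_nonneg.2 hp)
      have h3 : 0 ≤ 2 * L * (n * M ^ 2 - u x * u x) := by
        refine mul_nonneg (by positivity) (sub_nonneg.2 ?_)
        exact (hu2 x (ball_subset_closedBall hx)).trans
          (le_mul_of_one_le_left (sq_nonneg M) hn1)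
      refine (add_nonneg (add_nonneg h1 h2) h3).trans_eq ?_
      rw [hχ, hL]
      ring
    refine hlow.trans (Finset.sum_le_sum fun i _ => sub_nonneg.1 ?_)
    refine (mul_nonneg zero_le_two (sq_nonneg
      (χ * partialDeriv i (partialDeriv k u) x - 4 * x i * V))).trans_eq ?_
    ring
  · rw [mem_sphere_zero_iff_norm.1 hx]
    have := mul_le_mul_of_nonneg_left (hu2 x (sphere_subset_closedBall hx)) hL0
    linarith

end IsHelmholtz

lemma exists_abs_partialDeriv_le {n : ℕ} (hn : 0 < n) {r R : ℝ} (hr : 0 ≤ r) (hrR : r < R) :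
    ∃ C, 0 ≤ C ∧ ∀ u : EuclideanSpace ℝ (Fin n) → ℝ, IsHelmholtz u → ∀ M, 0 ≤ M →
      (∀ x ∈ closedBall (0 : EuclideanSpace ℝ (Fin n)) R, |u x| ≤ M) → ∀ k,
      ∀ x ∈ closedBall (0 : EuclideanSpace ℝ (Fin n)) r, |partialDeriv k u x| ≤ C * M := by
  have hχ0 : 0 < R ^ 2 - r ^ 2 := sub_pos.2 (by gcongr)
  refine ⟨√((12 * R ^ 2 + 2 * n * R ^ 2 + R ^ 4) * (1 + R ^ 2)) / (R ^ 2 - r ^ 2), by positivity,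
    fun u hu M hM0 hM k x hx => ?_⟩
  have hxr := mem_closedBall_zero_iff.1 hx
  have h := Real.abs_le_sqrt (hu.sq_partialDeriv_le hn hM k
    (closedBall_subset_closedBall hrR.le hx))
  rw [Real.sqrt_mul (by positivity), Real.sqrt_sq hM0, abs_mul] at h
  have hχ : R ^ 2 - r ^ 2 ≤ |R ^ 2 - ‖x‖ ^ 2| :=
    le_trans (by gcongr) (le_abs_self _)
  rw [div_mul_eq_mul_div, le_div_iff₀ hχ0, mul_comm]
  exact (mul_le_mul_of_nonneg_right hχ (abs_nonneg _)).trans h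

lemma fderiv_eq_sum_partialDeriv {n : ℕ} (f : EuclideanSpace ℝ (Fin n) → ℝ)
    (x : EuclideanSpace ℝ (Fin n)) :
    fderiv ℝ f x = ∑ i, (ContinuousLinearMap.toSpanSingleton ℝ
      (EuclideanSpace.proj i : EuclideanSpace ℝ (Fin n) →L[ℝ] ℝ)) (partialDeriv i f x) := by
  ext y
  have hy : y = ∑ i, y i • EuclideanSpace.single i (1 : ℝ) := by
    ext j
    simp [Pi.single_apply]
  conv_lhs => rw [hy, map_sum]
  simp [partialDeriv, mul_comm]

/-- Interior derivative estimates for solutions of the Helmholtz equation. -/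
lemma exists_norm_iteratedFDeriv_le {n : ℕ} (hn : 0 < n) (k : ℕ) {r R : ℝ} (hr : 0 ≤ r)
    (hrR : r < R) :
    ∃ C, 0 ≤ C ∧ ∀ u : EuclideanSpace ℝ (Fin n) → ℝ, IsHelmholtz u → ∀ M, 0 ≤ M →
      (∀ x ∈ closedBall (0 : EuclideanSpace ℝ (Fin n)) R, |u x| ≤ M) →
      ∀ x ∈ closedBall (0 : EuclideanSpace ℝ (Fin n)) r, ‖iteratedFDeriv ℝ k u x‖ ≤ C * M := by
  induction k generalizing R with
  | zero =>
    refine ⟨1, zero_le_one, fun u hu M _ hM x hx => ?_⟩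
    rw [norm_iteratedFDeriv_zero, one_mul]
    exact hM x (closedBall_subset_closedBall hrR.le hx)
  | succ k ih =>
    obtain ⟨s, hrs, hsR⟩ := exists_between hrR
    obtain ⟨C₁, hC₁, h₁⟩ := exists_abs_partialDeriv_le hn (hr.trans hrs.le) hsR
    obtain ⟨C₂, hC₂, h₂⟩ := ih hrs
    let e (i : Fin n) := ContinuousLinearMap.toSpanSingleton ℝ
      (EuclideanSpace.proj i : EuclideanSpace ℝ (Fin n) →L[ℝ] ℝ)
    refine ⟨∑ i, ‖e i‖ * (C₂ * C₁), by positivity, fun u hu M hM0 hM x hx => ?_⟩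
    have hsm (i : Fin n) : ContDiff ℝ (⊤ : ℕ∞) (partialDeriv i u) := (hu.partialDeriv i).contDiff
    rw [← norm_iteratedFDeriv_fderiv, funext (fderiv_eq_sum_partialDeriv u),
      iteratedFDeriv_fun_sum_apply, Finset.sum_mul]
    · refine norm_sum_le_of_le _ fun i _ => ?_
      refine ((e i).norm_iteratedFDeriv_comp_left (hsm i).contDiffAt
        (by exact_mod_cast le_top)).trans ?_
      rw [mul_assoc, mul_assoc]
      exact mul_le_mul_of_nonneg_left (h₂ _ (hu.partialDeriv i) (C₁ * M) (by positivity)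
        (fun x hx => h₁ u hu M hM0 hM i x hx) x hx) (norm_nonneg _)
    · exact fun i _ => (((e i).contDiff.comp (hsm i)).of_le (by exact_mod_cast le_top)).contDiffAt

lemma dist_iteratedFDeriv_succ {E F : Type*} [NormedAddCommGroup E] [NormedSpace ℝ E]
    [NormedAddCommGroup F] [NormedSpace ℝ F] (f g : E → F) (k : ℕ) (x : E) :
    dist (iteratedFDeriv ℝ (k + 1) f x) (iteratedFDeriv ℝ (k + 1) g x)
      = dist (fderiv ℝ (iteratedFDeriv ℝ k f) x) (fderiv ℝ (iteratedFDeriv ℝ k g) x) := by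
  rw [iteratedFDeriv_succ_eq_comp_left, iteratedFDeriv_succ_eq_comp_left, Function.comp_apply,
    Function.comp_apply, LinearIsometryEquiv.dist_map]

/-- Uniform convergence of smooth functions together with locally uniform Cauchy estimates on
all derivatives gives convergence of all derivatives. -/
lemma tendstoUniformlyOn_iteratedFDeriv {E F : Type*} [NormedAddCommGroup E] [NormedSpace ℝ E]
    [NormedAddCommGroup F] [NormedSpace ℝ F] [CompleteSpace F] {U : Set E} (hU : IsOpen U)
    {G : ℕ → E → F} {g : E → F} (hG : ∀ j, ContDiff ℝ (⊤ : ℕ∞) (G j))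
    (hlim : TendstoUniformlyOn G g atTop U)
    (hcau : ∀ k, UniformCauchySeqOn (fun j => iteratedFDeriv ℝ k (G j)) atTop U) (k : ℕ) :
    TendstoUniformlyOn (fun j => iteratedFDeriv ℝ k (G j)) (iteratedFDeriv ℝ k g) atTop U := by
  induction k with
  | zero =>
    rw [Metric.tendstoUniformlyOn_iff] at hlim ⊢
    intro ε hε
    filter_upwards [hlim ε hε] with j hj x hx
    have := hj x hx
    rw [dist_eq_norm] at this ⊢
    rw [iteratedFDeriv_zero_eq_comp, iteratedFDeriv_zero_eq_comp, Function.comp_apply,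
      Function.comp_apply, ← map_sub, LinearIsometryEquiv.norm_map]
    exact this
  | succ k ih =>
    have hdiff (j : ℕ) : Differentiable ℝ (iteratedFDeriv ℝ k (G j)) :=
      (hG j).differentiable_iteratedFDeriv (by exact_mod_cast ENat.natCast_lt_top k)
    have hc : UniformCauchySeqOn (fun j => fderiv ℝ (iteratedFDeriv ℝ k (G j))) atTop U := by
      refine (Metric.uniformCauchySeqOn_iff (α := E →L[ℝ] E [×k]→L[ℝ] F)).2 ?_
      intro ε hε
      obtain ⟨N, hN⟩ := Metric.uniformCauchySeqOn_iff.1 (hcau (k + 1)) ε hε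
      refine ⟨N, fun a ha b hb x hx => ?_⟩
      exact (dist_iteratedFDeriv_succ (G a) (G b) k x).symm.trans_lt (hN a ha b hb x hx)
    choose! D hD using fun x (hx : x ∈ U) => cauchySeq_tendsto_of_complete (hc.cauchySeq hx)
    have hDu := hc.tendstoUniformlyOn_of_tendsto hD
    have hderiv (x) (hx : x ∈ U) : fderiv ℝ (iteratedFDeriv ℝ k g) x = D x :=
      (hasFDerivAt_of_tendstoUniformlyOn hU hDu (fun j x _ => (hdiff j x).hasFDerivAt)
        (fun x hx => ih.tendsto_at hx) hx).fderiv
    rw [Metric.tendstoUniformlyOn_iff]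
    intro ε hε
    filter_upwards [(Metric.tendstoUniformlyOn_iff (α := E →L[ℝ] E [×k]→L[ℝ] F)).1 hDu ε hε]
      with j hj x hx
    rw [dist_iteratedFDeriv_succ, hderiv x hx]
    exact hj x hx

lemma exists_besselMode_sum_iteratedFDeriv_near {n : ℕ} (hn : 0 < n) {ν : ℝ} (hν : 0 ≤ ν)
    (hnν : (n : ℝ) = 2 * (ν + 1)) {r R : ℝ} (hr : 0 ≤ r) (hrR : r < R)
    {g : EuclideanSpace ℝ (Fin n) → ℝ} (hg : ContDiff ℝ 2 g)
    (hpde : ∀ x ∈ ball (0 : EuclideanSpace ℝ (Fin n)) R, lap g x + g x = 0) (t : ℕ) {ε : ℝ}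
    (hε : 0 < ε) :
    ∃ (d : ℕ) (P : ℕ → MvPolynomial (Fin n) ℝ),
      (∀ ℓ, (P ℓ).IsHomogeneous ℓ ∧ mvLap n (P ℓ) = 0) ∧
      ∀ i ≤ t, ∀ x ∈ ball (0 : EuclideanSpace ℝ (Fin n)) r,
        ‖iteratedFDeriv ℝ i g x - iteratedFDeriv ℝ i
          (fun x => ∑ ℓ ∈ Finset.range d, besselMode (ℓ + ν) (P ℓ) x) x‖ ≤ ε := by
  choose d P hP hdist using fun j : ℕ => exists_besselMode_sum_near hn hν hnν
    (hr.trans_lt hrR) hg hpde (Nat.one_div_pos_of_nat (α := ℝ) (n := j))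
  set G : ℕ → EuclideanSpace ℝ (Fin n) → ℝ :=
    fun j x => ∑ ℓ ∈ Finset.range (d j), besselMode (ℓ + ν) (P j ℓ) x with hG_def
  have hG (j : ℕ) : IsHelmholtz (G j) := .sum _ fun ℓ =>
    .of_lap (contDiff_besselMode (by positivity) _) (lap_besselMode hν hnν (hP j ℓ).1 (hP j ℓ).2)
  have hsmall {δ : ℝ} (hδ : 0 < δ) : ∀ᶠ j : ℕ in atTop, 1 / ((j : ℝ) + 1) < δ :=
    (tendsto_one_div_add_atTop_nhds_zero_nat (𝕜 := ℝ)).eventually (gt_mem_nhds hδ)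
  have hsub : ball (0 : EuclideanSpace ℝ (Fin n)) r ⊆ closedBall 0 R :=
    (ball_subset_ball hrR.le).trans ball_subset_closedBall
  have hlim : TendstoUniformlyOn G g atTop (ball 0 r) := by
    rw [Metric.tendstoUniformlyOn_iff]
    intro δ hδ
    filter_upwards [hsmall hδ] with j hj x hx
    exact (hdist j x (hsub hx)).trans_lt hj
  have hcau (k : ℕ) :
      UniformCauchySeqOn (fun j => iteratedFDeriv ℝ k (G j)) atTop (ball 0 r) := by
    rw [Metric.uniformCauchySeqOn_iff]
    intro δ hδ
    obtain ⟨C, hC, hCu⟩ := exists_norm_iteratedFDeriv_le hn k hr hrR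
    obtain ⟨N, hN⟩ := eventually_atTop.1 (hsmall (show 0 < δ / (2 * (C + 1)) by positivity))
    refine ⟨N, fun a ha b hb x hx => ?_⟩
    have key := hCu _ ((hG a).sub (hG b)) (δ / (C + 1)) (by positivity) (fun y hy => ?_) x
      (ball_subset_closedBall hx)
    · have hk (j : ℕ) : ContDiffAt ℝ k (G j) x :=
        ((hG j).contDiff.of_le (mod_cast le_top)).contDiffAt
      rw [dist_eq_norm, ← iteratedFDeriv_sub_apply (hk a) (hk b)]
      refine key.trans_lt ?_
      rw [← mul_div_assoc, div_lt_iff₀ (by positivity)]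
      nlinarith
    · have e : δ / (C + 1) = δ / (2 * (C + 1)) + δ / (2 * (C + 1)) := by
        field_simp
        ring
      have h₁ := (hdist a y hy).trans (hN a ha).le
      have h₂ := (hdist b y hy).trans (hN b hb).le
      rw [e]
      calc |G a y - G b y| = |(g y - G b y) - (g y - G a y)| := by ring_nf
        _ ≤ |g y - G b y| + |g y - G a y| := abs_sub _ _
        _ ≤ _ := add_le_add h₂ h₁
  have hev : ∀ᶠ j in atTop, ∀ i ∈ Finset.range (t + 1),
      ∀ x ∈ ball (0 : EuclideanSpace ℝ (Fin n)) r,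
        dist (iteratedFDeriv ℝ i g x) (iteratedFDeriv ℝ i (G j) x) < ε :=
    (eventually_all_finset _).2 fun i _ => Metric.tendstoUniformlyOn_iff.1
      (tendstoUniformlyOn_iteratedFDeriv isOpen_ball (fun j => (hG j).contDiff) hlim hcau i) ε hε
  obtain ⟨j, hj⟩ := hev.exists
  refine ⟨d j, P j, hP j, fun i hi x hx => ?_⟩
  rw [← dist_eq_norm]
  exact (hj i (Finset.mem_range.2 (by omega)) x hx).le

lemma exists_contDiff_eqOn_ball {E : Type*} [NormedAddCommGroup E] [InnerProductSpace ℝ E]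
    {n : ℕ∞} {r R : ℝ} (hr : 0 < r) (hrR : r < R) {g : E → ℝ}
    (hg : ContDiffOn ℝ n g (ball 0 R)) :
    ∃ f : E → ℝ, ContDiff ℝ n f ∧ Set.EqOn f g (ball 0 r) := by
  obtain ⟨s, hrs, hsR⟩ := exists_between hrR
  let χ : ContDiffBump (0 : E) := ⟨r, s, hr, hrs⟩
  refine ⟨fun x => χ x * g x, contDiff_iff_contDiffAt.2 fun x => ?_, fun x hx => ?_⟩
  · by_cases hx : x ∈ ball 0 R
    · exact χ.contDiffAt.mul (hg.contDiffAt (isOpen_ball.mem_nhds hx))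
    · refine (contDiffAt_const (c := (0 : ℝ))).congr_of_eventuallyEq ?_
      have hs : x ∈ (closedBall (0 : E) s)ᶜ := fun h => hx (closedBall_subset_ball hsR h)
      filter_upwards [isClosed_closedBall.isOpen_compl.mem_nhds hs] with y hy
      rw [χ.zero_of_le_dist (not_le.1 (mt mem_closedBall.2 hy)).le, zero_mul]
  · change χ x * g x = g x
    rw [χ.one_of_mem_closedBall (ball_subset_closedBall hx), one_mul]

lemma besselMode_eq_mul_besselJ {n ℓ : ℕ} {P : MvPolynomial (Fin n) ℝ} (hP : P.IsHomogeneous ℓ)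
    (ν : ℝ) {x : EuclideanSpace ℝ (Fin n)} (hx : x ≠ 0) :
    besselMode (ℓ + ν) P x = 2 ^ ((ℓ : ℝ) + ν) * sphEval P (‖x‖⁻¹ • x)
      * besselJ (ℓ + ν) ‖x‖ / ‖x‖ ^ ν := by
  have hx0 : 0 < ‖x‖ := norm_pos_iff.2 hx
  rw [besselMode, besselJ_eq_besselClifford, sphEval_smul hP, Real.div_rpow hx0.le zero_le_two,
    Real.rpow_add hx0, Real.rpow_natCast, inv_pow]
  field_simp

/-- Every `C²` solution of `Δg + g = 0` on a ball centered at the origin can be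
approximated in `C^t` on compact subsets by finite linear combinations of the
functions `x ↦ Y^ℓ_m(x/|x|) J_{ℓ+ν}(|x|)/|x|^ν`. -/
theorem stmt10 (n : ℕ) (hn : 2 ≤ n) (R : ℝ) (hR : 0 < R)
    (g : EuclideanSpace ℝ (Fin n) → ℝ)
    (hg : ContDiffOn ℝ 2 g (ball (0 : EuclideanSpace ℝ (Fin n)) R))
    (hpde : ∀ x ∈ ball (0 : EuclideanSpace ℝ (Fin n)) R, lap g x + g x = 0)
    (t : ℕ) (K : Set (EuclideanSpace ℝ (Fin n)))
    (hK : IsCompact K) (hKB : K ⊆ ball (0 : EuclideanSpace ℝ (Fin n)) R)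
    (ε : ℝ) (hε : 0 < ε) :
    let ν : ℝ := ((n : ℝ) - 2) / 2
    ∃ (m : ℕ) (c : Fin m → ℝ) (ℓ : Fin m → ℕ)
      (P : Fin m → MvPolynomial (Fin n) ℝ) (G : EuclideanSpace ℝ (Fin n) → ℝ),
      (∀ j, IsHarmonicHomogeneous n (ℓ j) (P j)) ∧
      ContDiff ℝ (⊤ : ℕ∞) G ∧
      (∀ x : EuclideanSpace ℝ (Fin n), x ≠ 0 →
        G x = ∑ j, c j * sphEval (P j) (‖x‖⁻¹ • x)
          * besselJ ((ℓ j : ℝ) + ν) ‖x‖ / ‖x‖ ^ ν) ∧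
      ∀ i : ℕ, i ≤ t → ∀ x ∈ K,
        ‖iteratedFDeriv ℝ i g x - iteratedFDeriv ℝ i G x‖ ≤ ε := by
  intro ν
  have hν : 0 ≤ ν := div_nonneg (sub_nonneg.2 (mod_cast hn)) zero_le_two
  have hnν : (n : ℝ) = 2 * (ν + 1) := by
    simp only [ν]
    ring
  obtain ⟨r, hrR, hKr⟩ := exists_lt_subset_ball hK.isClosed hKB
  obtain ⟨s, hs, hsR⟩ := exists_between (max_lt hrR hR)
  obtain ⟨hrs, hs0⟩ := max_lt_iff.1 hs
  obtain ⟨f, hf, hfg⟩ := exists_contDiff_eqOn_ball (n := 2) hs0 hsR hg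
  have hfgx {x : EuclideanSpace ℝ (Fin n)} (hx : x ∈ ball 0 s) : f =ᶠ[nhds x] g :=
    hfg.eventuallyEq_of_mem (isOpen_ball.mem_nhds hx)
  have hfpde : ∀ x ∈ ball (0 : EuclideanSpace ℝ (Fin n)) s, lap f x + f x = 0 := by
    intro x hx
    rw [lap, ((hfgx hx).iteratedFDeriv ℝ 2).eq_of_nhds, hfg hx]
    exact hpde x (ball_subset_ball hsR.le hx)
  obtain ⟨d, P, hP, hfP⟩ := exists_besselMode_sum_iteratedFDeriv_near (by omega) hν hnν
    (le_max_right r 0) hs hf hfpde t hε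
  refine ⟨d, fun j => 2 ^ ((j : ℝ) + ν), fun j => j, fun j => P j,
    fun x => ∑ ℓ ∈ Finset.range d, besselMode (ℓ + ν) (P ℓ) x,
    fun j => isHarmonicHomogeneous_of_mvLap_eq_zero (hP j).1 (hP j).2,
    ContDiff.sum fun ℓ _ => contDiff_besselMode (by positivity) _, fun x hx => ?_,
    fun i hi x hx => ?_⟩
  · exact (Finset.sum_range _).trans
      (Finset.sum_congr rfl fun j _ => besselMode_eq_mul_besselJ (hP j).1 ν hx)
  · rw [← ((hfgx (ball_subset_ball hrs.le (hKr hx))).iteratedFDeriv ℝ i).eq_of_nhds]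
    exact hfP i hi x (ball_subset_ball (le_max_left _ _) (hKr hx))

end
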